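/- arXiv:2402.11280 — 3 statements merged into one kernel-verified Lean document; each statement's English description precedes it below -/
import Mathlib

section
/- Under Assumption A, suppose the continuous HiSD system dx/dt = β(I − 2Σ_{j=1}^k v_j v_jᵀ)F(x), dv_i/dt = γ J(x) v_i + γ(−v_i v_iᵀ − 2Σ_{j=1}^{i−1} v_j v_jᵀ) J(x) v_i (1 ≤ i ≤ k) has a twice continuously differentiable solution (x(t), v_1(t), …, v_k(t)) on [0, T] with x(0) = x₀ and v_i(0) = v_{i,0}. Then there exist τ₀ > 0 and Q > 0, independent of τ, n and N, such that for every N ∈ ℕ with τ = T/N ≤ τ₀, the iterates of the discrete HiSD scheme satisfy, with t_n = nτ, ‖x(t_n) − x_n‖ + Σ_{i=1}^k ‖v_i(t_n) − v_{i,n}‖ ≤ Q τ for all 1 ≤ n ≤ N. -/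
open scoped RealInnerProductSpace BigOperators

noncomputable section

section helpers
set_option linter.unusedSectionVars false
open scoped Topology
open Asymptotics Filter

variable {E : Type*} [NormedAddCommGroup E] [InnerProductSpace ℝ E]

lemma bigO_inner {ι : Type*} {l : Filter ι} {f g : ι → E} {a b : ι → ℝ}
    (hf : f =O[l] a) (hg : g =O[l] b) : (fun p => ⟪f p, g p⟫) =O[l] (fun p => a p * b p) := by
  have h1 : (fun p => ⟪f p, g p⟫) =O[l] (fun p => ‖f p‖ * ‖g p‖) := by
    refine IsBigO.of_bound 1 (Eventually.of_forall fun p => ?_)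
    have := norm_inner_le_norm (𝕜 := ℝ) (f p) (g p)
    simpa using this
  exact h1.trans (hf.norm_left.mul hg.norm_left)

/-- Right-hand side of the direction equation with `B = γ J`. -/
def gB {k : ℕ} (B : E →L[ℝ] E) (v : Fin k → E) (i : Fin k) : E :=
  B (v i) + ((-⟪v i, B (v i)⟫) • v i - (2:ℝ) • ∑ j ∈ Finset.Iio i, ⟪v j, B (v i)⟫ • v j)

/-- Expansion of normalisation. -/
lemma normalize_expand {ι : Type*} {l : Filter ι} {τ : ι → ℝ} (hτ : Tendsto τ l (𝓝 0))
    {u h w u' : ι → E} (hu : ∀ p, ‖u p‖ = 1) (hu' : ∀ p, ‖u' p‖ = 1)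
    (hh : h =O[l] (fun _ => (1:ℝ)))
    (hw : (fun p => w p - u p - τ p • h p) =O[l] (fun p => τ p ^ 2))
    (hww : ∀ p, w p = ‖w p‖ • u' p) :
    (fun p => u' p - u p - τ p • (h p - ⟪u p, h p⟫ • u p)) =O[l] (fun p => τ p ^ 2) := by
  have hτ1 : τ =O[l] (fun _ => (1:ℝ)) := hτ.isBigO_one ℝ
  have hττ : τ =O[l] τ := isBigO_refl _ _
  have hu1 : u =O[l] (fun _ => (1:ℝ)) :=
    IsBigO.of_bound 1 (Eventually.of_forall fun p => by simp [hu])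
  have hup1 : u' =O[l] (fun _ => (1:ℝ)) :=
    IsBigO.of_bound 1 (Eventually.of_forall fun p => by simp [hu'])
  have hτ2 : (fun p => τ p ^ 2) =O[l] τ := by
    simpa [pow_two] using hττ.mul hτ1
  have hτh : (fun p => τ p • h p) =O[l] τ := by simpa using hττ.smul hh
  have hwu : (fun p => w p - u p) =O[l] τ := by
    have := (hw.trans hτ2).add hτh
    simpa using this
  have hw1 : w =O[l] (fun _ => (1:ℝ)) := by
    have := (hwu.trans hτ1).add hu1
    simpa using this
  have huh : (fun p => ⟪u p, h p⟫) =O[l] (fun _ => (1:ℝ)) := by simpa using bigO_inner hu1 hh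
  have hτuh : (fun p => τ p * ⟪u p, h p⟫) =O[l] τ := by simpa using hττ.mul huh
  -- norm expansion
  have hsq : (fun p => ‖w p‖ ^ 2 - 1 - 2 * (τ p * ⟪u p, h p⟫)) =O[l] (fun p => τ p ^ 2) := by
    have h1 : (fun p => ⟪w p - u p, w p - u p⟫) =O[l] (fun p => τ p ^ 2) := by
      simpa [pow_two] using bigO_inner hwu hwu
    have h2 : (fun p => 2 * ⟪u p, w p - u p - τ p • h p⟫) =O[l] (fun p => τ p ^ 2) := by
      simpa using (bigO_inner hu1 hw).const_mul_left 2
    refine (h1.add h2).congr_left fun p => ?_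
    have h3 : ⟪u p, u p⟫ = 1 := by rw [real_inner_self_eq_norm_sq, hu]; norm_num
    simp only [inner_sub_left, inner_sub_right, real_inner_smul_right, h3,
      real_inner_self_eq_norm_sq (w p), real_inner_comm (w p) (u p)]
    ring
  have hsq1 : (fun p => ‖w p‖ ^ 2 - 1) =O[l] τ := by
    have := (hsq.trans hτ2).add (hτuh.const_mul_left 2)
    simpa using this
  have hs1 : (fun p => ‖w p‖ - 1) =O[l] τ := by
    refine IsBigO.trans (IsBigO.of_bound 1 (Eventually.of_forall fun p => ?_)) hsq1
    have : ‖w p‖ ^ 2 - 1 = (‖w p‖ - 1) * (‖w p‖ + 1) := by ring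
    rw [this, norm_mul, one_mul]
    refine le_mul_of_one_le_right (norm_nonneg _) ?_
    rw [Real.norm_of_nonneg (by positivity)]
    linarith [norm_nonneg (w p)]
  have hs1sq : (fun p => (‖w p‖ - 1) ^ 2) =O[l] (fun p => τ p ^ 2) := hs1.pow 2
  have hs : (fun p => ‖w p‖ - 1 - τ p * ⟪u p, h p⟫) =O[l] (fun p => τ p ^ 2) := by
    refine ((hsq.sub hs1sq).const_mul_left (1/2)).congr_left fun p => ?_
    ring
  -- assemble
  have a1 : (fun p => (‖w p‖ - 1 - τ p * ⟪u p, h p⟫) • w p) =O[l] (fun p => τ p ^ 2) := by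
    simpa using hs.smul hw1
  have a2 : (fun p => (τ p * ⟪u p, h p⟫) • (w p - u p)) =O[l] (fun p => τ p ^ 2) := by
    simpa [pow_two] using hτuh.smul hwu
  have a3 : (fun p => ((‖w p‖ - 1) ^ 2) • u' p) =O[l] (fun p => τ p ^ 2) := by
    simpa using hs1sq.smul hup1
  refine (((hw.sub a1).sub a2).add a3).congr_left fun p => ?_
  have e := hww p
  generalize hs : ‖w p‖ = s at *
  rw [e]
  module

lemma gs_step {ι : Type*} {l : Filter ι} {k : ℕ} {τ : ι → ℝ} (hτ : Tendsto τ l (𝓝 0))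
    {B : ι → (E →L[ℝ] E)} {K : ℝ} (hB : ∀ p, ‖B p‖ ≤ K)
    (hsym : ∀ p u w, ⟪B p u, w⟫ = ⟪u, B p w⟫)
    {v v' : ι → Fin k → E}
    (hv : ∀ p i j, ⟪v p i, v p j⟫ = if i = j then (1:ℝ) else 0)
    (hv' : ∀ p i, ‖v' p i‖ = 1)
    (hgs : ∀ p i, (v p i + τ p • B p (v p i)
        - ∑ j ∈ Finset.Iio i, ⟪v p i + τ p • B p (v p i), v' p j⟫ • v' p j)
      = ‖v p i + τ p • B p (v p i)
        - ∑ j ∈ Finset.Iio i, ⟪v p i + τ p • B p (v p i), v' p j⟫ • v' p j‖ • v' p i)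
    (i : Fin k) :
    (fun p => v' p i - v p i - τ p • gB (B p) (v p) i) =O[l] (fun p => τ p ^ 2) := by
  have hτ1 : τ =O[l] (fun _ => (1:ℝ)) := hτ.isBigO_one ℝ
  have hττ : τ =O[l] τ := isBigO_refl _ _
  have hτ2 : (fun p => τ p ^ 2) =O[l] τ := by
    simpa [pow_two] using hττ.mul hτ1
  have hnv : ∀ p i, ‖v p i‖ = 1 := fun p i => by
    have := hv p i i
    rw [real_inner_self_eq_norm_sq] at this
    simp only [if_true] at this
    nlinarith [norm_nonneg (v p i)]
  have hv1 : ∀ i, (fun p => v p i) =O[l] (fun _ => (1:ℝ)) := fun i =>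
    IsBigO.of_bound 1 (Eventually.of_forall fun p => by simp [hnv])
  have hvp1 : ∀ i, (fun p => v' p i) =O[l] (fun _ => (1:ℝ)) := fun i =>
    IsBigO.of_bound 1 (Eventually.of_forall fun p => by simp [hv'])
  have hb1 : ∀ i, (fun p => B p (v p i)) =O[l] (fun _ => (1:ℝ)) := fun i =>
    IsBigO.of_bound K (Eventually.of_forall fun p => by
      have := (B p).le_opNorm (v p i)
      rw [hnv, mul_one] at this
      simpa using this.trans (hB p))
  have hm1 : ∀ i j, (fun p => ⟪v p j, B p (v p i)⟫) =O[l] (fun _ => (1:ℝ)) := fun i j => by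
    simpa using bigO_inner (hv1 j) (hb1 i)
  have hmv1 : ∀ i j, (fun p => ⟪v p j, B p (v p i)⟫ • v p j) =O[l] (fun _ => (1:ℝ)) :=
    fun i j => by simpa using (hm1 i j).smul (hv1 j)
  have hh1 : ∀ i, (fun p => B p (v p i) - (2:ℝ) • ∑ j ∈ Finset.Iio i,
      ⟪v p j, B p (v p i)⟫ • v p j) =O[l] (fun _ => (1:ℝ)) := fun i =>
    (hb1 i).sub ((IsBigO.fun_sum fun j _ => hmv1 i j).const_smul_left (2:ℝ))
  have hg1 : ∀ i, (fun p => gB (B p) (v p) i) =O[l] (fun _ => (1:ℝ)) := fun i => by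
    refine ((hh1 i).sub (hmv1 i i)).congr_left fun p => ?_
    simp only [gB]; module
  induction i using WellFoundedLT.induction with
  | ind i ih =>
  have hc : ∀ j ∈ Finset.Iio i, (fun p => ⟪v p i + τ p • B p (v p i), v' p j⟫ • v' p j
      - τ p • (2:ℝ) • ⟪v p j, B p (v p i)⟫ • v p j) =O[l] (fun p => τ p ^ 2) := by
    intro j hj
    have hji : j < i := Finset.mem_Iio.1 hj
    have hR := ih j hji
    have hvt : (fun p => v p i + τ p • B p (v p i)) =O[l] (fun _ => (1:ℝ)) :=
      (hv1 i).add (by simpa using hτ1.smul (hb1 i))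
    have hτg : (fun p => τ p • gB (B p) (v p) j) =O[l] τ := by simpa using hττ.smul (hg1 j)
    have hd : (fun p => v' p j - v p j) =O[l] τ := by
      simpa using (hR.trans hτ2).add hτg
    have b1 : (fun p => ⟪v p i + τ p • B p (v p i), v' p j - v p j - τ p • gB (B p) (v p) j⟫)
        =O[l] (fun p => τ p ^ 2) := by simpa using bigO_inner hvt hR
    have b2 : (fun p => τ p ^ 2 * ⟪B p (v p i), gB (B p) (v p) j⟫) =O[l] (fun p => τ p ^ 2) := by
      simpa using (isBigO_refl (fun p => τ p ^ 2) l).mul (bigO_inner (hb1 i) (hg1 j))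
    have b3 : (fun p => ⟪v p i + τ p • B p (v p i), v' p j⟫ - τ p * (2 * ⟪v p j, B p (v p i)⟫))
        =O[l] (fun p => τ p ^ 2) := by
      refine (b1.add b2).congr_left fun p => ?_
      have e1 : ⟪v p i, v p j⟫ = 0 := by rw [hv, if_neg hji.ne']
      have e2 : ⟪v p i, gB (B p) (v p) j⟫ = ⟪v p j, B p (v p i)⟫ := by
        simp only [gB, inner_add_right, inner_sub_right, real_inner_smul_right, inner_sum, e1]
        rw [Finset.sum_eq_zero, ← hsym, real_inner_comm]
        · ring
        · intro m hm
          rw [hv, if_neg ((Finset.mem_Iio.1 hm).trans hji).ne', mul_zero]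
      have e3 : ⟪B p (v p i), v p j⟫ = ⟪v p j, B p (v p i)⟫ := real_inner_comm _ _
      simp only [inner_add_left, inner_sub_right, real_inner_smul_left, real_inner_smul_right,
        e1, e2, e3]
      ring
    have b4 : (fun p => (⟪v p i + τ p • B p (v p i), v' p j⟫ - τ p * (2 * ⟪v p j, B p (v p i)⟫))
        • v' p j) =O[l] (fun p => τ p ^ 2) := by simpa using b3.smul (hvp1 j)
    have b5 : (fun p => (τ p * (2 * ⟪v p j, B p (v p i)⟫)) • (v' p j - v p j))
        =O[l] (fun p => τ p ^ 2) := by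
      have := (hττ.mul ((hm1 i j).const_mul_left 2)).smul hd
      simpa [pow_two] using this
    refine (b4.add b5).congr_left fun p => ?_
    module
  have hw : (fun p => (v p i + τ p • B p (v p i)
        - ∑ j ∈ Finset.Iio i, ⟪v p i + τ p • B p (v p i), v' p j⟫ • v' p j) - v p i
        - τ p • (B p (v p i) - (2:ℝ) • ∑ j ∈ Finset.Iio i, ⟪v p j, B p (v p i)⟫ • v p j))
        =O[l] (fun p => τ p ^ 2) := by
    refine (IsBigO.fun_sum hc).neg_left.congr_left fun p => ?_
    rw [Finset.sum_sub_distrib, ← Finset.smul_sum, ← Finset.smul_sum]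
    module
  refine (normalize_expand hτ (fun p => hnv p i) (fun p => hv' p i) (hh1 i) hw
    (fun p => hgs p i)).congr_left fun p => ?_
  have e : ⟪v p i, B p (v p i) - (2:ℝ) • ∑ j ∈ Finset.Iio i, ⟪v p j, B p (v p i)⟫ • v p j⟫
      = ⟪v p i, B p (v p i)⟫ := by
    simp only [inner_sub_right, real_inner_smul_right, inner_sum]
    rw [Finset.sum_eq_zero]
    · ring
    · intro m hm
      rw [hv, if_neg (Finset.mem_Iio.1 hm).ne', mul_zero]
  rw [e]
  simp only [gB]
  module

lemma gs_orth {k : ℕ} {vt v' : Fin k → E}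
    (hgs : ∀ i, (vt i - ∑ j ∈ Finset.Iio i, ⟪vt i, v' j⟫ • v' j) ≠ 0 ∧
      v' i = ‖vt i - ∑ j ∈ Finset.Iio i, ⟪vt i, v' j⟫ • v' j‖⁻¹ •
        (vt i - ∑ j ∈ Finset.Iio i, ⟪vt i, v' j⟫ • v' j)) (i j : Fin k) :
    ⟪v' i, v' j⟫ = if i = j then (1:ℝ) else 0 := by
  have hn : ∀ i, ⟪v' i, v' i⟫ = 1 := fun i => by
    rw [real_inner_self_eq_norm_sq, (hgs i).2, norm_smul, norm_inv, norm_norm,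
      inv_mul_cancel₀ (norm_ne_zero_iff.2 (hgs i).1)]
    norm_num
  have key : ∀ i, ∀ j < i, ⟪v' i, v' j⟫ = 0 := by
    intro i
    induction i using WellFoundedLT.induction with
    | ind i ih =>
    intro j hj
    rw [(hgs i).2, real_inner_smul_left]
    refine mul_eq_zero_of_right _ ?_
    rw [inner_sub_left, sum_inner,
      Finset.sum_eq_single_of_mem j (Finset.mem_Iio.2 hj)]
    · rw [real_inner_smul_left, hn]; ring
    · intro m hm hmj
      rw [real_inner_smul_left]
      rcases lt_or_gt_of_ne hmj with h | h
      · rw [real_inner_comm (v' j) (v' m), ih j hj m h, mul_zero]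
      · rw [ih m (Finset.mem_Iio.1 hm) j h, mul_zero]
  rcases lt_trichotomy i j with h | h | h
  · rw [if_neg h.ne, real_inner_comm, key j i h]
  · rw [if_pos h, h, hn]
  · rw [if_neg h.ne', key i j h]

lemma taylor2 {G : Type*} [NormedAddCommGroup G] [NormedSpace ℝ G] {T : ℝ} (hT : 0 < T)
    {f f' : ℝ → G} (hf : ContDiffOn ℝ 2 f (Set.Icc 0 T))
    (hd : ∀ t ∈ Set.Icc 0 T, HasDerivWithinAt f (f' t) (Set.Icc 0 T) t) :
    ∃ C : ℝ, 0 ≤ C ∧ ∀ t ∈ Set.Icc 0 T, ∀ s ∈ Set.Icc 0 T, t ≤ s →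
      ‖f s - f t - (s - t) • f' t‖ ≤ C * (s - t) ^ 2 := by
  have hu := uniqueDiffOn_Icc hT
  have h1 : ContDiffOn ℝ 1 (derivWithin f (Set.Icc 0 T)) (Set.Icc 0 T) :=
    hf.derivWithin hu (by norm_num)
  have h2 : ContDiffOn ℝ 1 f' (Set.Icc 0 T) :=
    h1.congr fun t ht => ((hd t ht).derivWithin (hu t ht)).symm
  obtain ⟨K, hK⟩ := h2.exists_lipschitzOnWith (by norm_num) (convex_Icc 0 T) isCompact_Icc
  refine ⟨K, K.2, fun t ht s hs hts => ?_⟩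
  have hsub : Set.Icc t s ⊆ Set.Icc 0 T := Set.Icc_subset_Icc ht.1 hs.2
  have := (convex_Icc t s).norm_image_sub_le_of_norm_hasDerivWithin_le
    (f := fun r => f r - (r - t) • f' t) (f' := fun r => f' r - (1:ℝ) • f' t)
    (C := K * (s - t)) (x := t) (y := s) ?_ ?_ ⟨le_rfl, hts⟩ ⟨hts, le_rfl⟩
  · rw [Real.norm_of_nonneg (by linarith)] at this
    simp only [sub_self, zero_smul, sub_zero] at this
    rw [sub_right_comm]
    linarith
  · intro r hr
    exact ((hd r (hsub hr)).mono hsub).sub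
      ((((hasDerivAt_id r).sub_const t).smul_const (f' t)).hasDerivWithinAt)
  · intro r hr
    rw [one_smul]
    refine (hK.norm_sub_le (hsub hr) ht).trans ?_
    rw [Real.norm_of_nonneg (by linarith [hr.1])]
    exact mul_le_mul_of_nonneg_left (by linarith [hr.2]) K.2

/-- `f` and `f'` are bounded and their difference is controlled by `ε`. -/
def BL {ι G : Type*} [NormedAddCommGroup G] (l : Filter ι) (ε : ι → ℝ) (f f' : ι → G) : Prop :=
  f =O[l] (fun _ => (1:ℝ)) ∧ f' =O[l] (fun _ => (1:ℝ)) ∧ (fun p => f p - f' p) =O[l] ε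

section BL
variable {ι : Type*} {l : Filter ι} {ε : ι → ℝ}

lemma BL.add {f f' g g' : ι → E} (hf : BL l ε f f') (hg : BL l ε g g') :
    BL l ε (fun p => f p + g p) (fun p => f' p + g' p) :=
  ⟨hf.1.add hg.1, hf.2.1.add hg.2.1, (hf.2.2.add hg.2.2).congr_left fun p => by module⟩

lemma BL.sub {f f' g g' : ι → E} (hf : BL l ε f f') (hg : BL l ε g g') :
    BL l ε (fun p => f p - g p) (fun p => f' p - g' p) :=
  ⟨hf.1.sub hg.1, hf.2.1.sub hg.2.1, (hf.2.2.sub hg.2.2).congr_left fun p => by module⟩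

lemma BL.neg {f f' : ι → ℝ} (hf : BL l ε f f') :
    BL l ε (fun p => - f p) (fun p => - f' p) :=
  ⟨hf.1.neg_left, hf.2.1.neg_left, hf.2.2.neg_left.congr_left fun p => by ring⟩

lemma BL.const_smul {G : Type*} [NormedAddCommGroup G] [NormedSpace ℝ G] {f f' : ι → G}
    (c : ℝ) (hf : BL l ε f f') :
    BL l ε (fun p => c • f p) (fun p => c • f' p) :=
  ⟨hf.1.const_smul_left c, hf.2.1.const_smul_left c,
    (hf.2.2.const_smul_left c).congr_left fun p => by simp [smul_sub]⟩

lemma BL.smul {a a' : ι → ℝ} {f f' : ι → E} (ha : BL l ε a a') (hf : BL l ε f f') :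
    BL l ε (fun p => a p • f p) (fun p => a' p • f' p) := by
  refine ⟨by simpa using ha.1.smul hf.1, by simpa using ha.2.1.smul hf.2.1, ?_⟩
  have h1 : (fun p => (a p - a' p) • f p) =O[l] ε := by simpa using ha.2.2.smul hf.1
  have h2 : (fun p => a' p • (f p - f' p)) =O[l] ε := by simpa using ha.2.1.smul hf.2.2
  exact (h1.add h2).congr_left fun p => by module

lemma BL.inner {f f' g g' : ι → E} (hf : BL l ε f f') (hg : BL l ε g g') :
    BL l ε (fun p => ⟪f p, g p⟫) (fun p => ⟪f' p, g' p⟫) := by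
  refine ⟨by simpa using bigO_inner hf.1 hg.1, by simpa using bigO_inner hf.2.1 hg.2.1, ?_⟩
  have h1 : (fun p => ⟪f p - f' p, g p⟫) =O[l] ε := by simpa using bigO_inner hf.2.2 hg.1
  have h2 : (fun p => ⟪f' p, g p - g' p⟫) =O[l] ε := by simpa using bigO_inner hf.2.1 hg.2.2
  exact (h1.add h2).congr_left fun p => by simp only [inner_sub_left, inner_sub_right]; ring

lemma bigO_clm {A : ι → (E →L[ℝ] E)} {f : ι → E} {a b : ι → ℝ}
    (hA : A =O[l] a) (hf : f =O[l] b) : (fun p => A p (f p)) =O[l] (fun p => a p * b p) := by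
  have h1 : (fun p => A p (f p)) =O[l] (fun p => ‖A p‖ * ‖f p‖) := by
    refine IsBigO.of_bound 1 (Eventually.of_forall fun p => ?_)
    simpa using (A p).le_opNorm (f p)
  exact h1.trans (hA.norm_left.mul hf.norm_left)

lemma BL.clm {A A' : ι → (E →L[ℝ] E)} {f f' : ι → E} (hA : BL l ε A A') (hf : BL l ε f f') :
    BL l ε (fun p => A p (f p)) (fun p => A' p (f' p)) := by
  refine ⟨by simpa using bigO_clm hA.1 hf.1, by simpa using bigO_clm hA.2.1 hf.2.1, ?_⟩
  have h1 : (fun p => (A p - A' p) (f p)) =O[l] ε := by simpa using bigO_clm hA.2.2 hf.1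
  have h2 : (fun p => A' p (f p - f' p)) =O[l] ε := by simpa using bigO_clm hA.2.1 hf.2.2
  exact (h1.add h2).congr_left fun p => by simp

lemma BL.sum {κ : Type*} {s : Finset κ} {f f' : κ → ι → E} (hf : ∀ j, BL l ε (f j) (f' j)) :
    BL l ε (fun p => ∑ j ∈ s, f j p) (fun p => ∑ j ∈ s, f' j p) :=
  ⟨IsBigO.fun_sum fun j _ => (hf j).1, IsBigO.fun_sum fun j _ => (hf j).2.1,
    (IsBigO.fun_sum (s := s) fun j _ => (hf j).2.2).congr_left fun p => by
      rw [Finset.sum_sub_distrib]⟩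

end BL

/-- Right-hand side of the position equation. -/
def gX {k : ℕ} (β : ℝ) (f : E) (v : Fin k → E) : E :=
  β • (f - (2:ℝ) • ∑ j, ⟪v j, f⟫ • v j)

lemma lip_const {k : ℕ} (F : E → E) (J : E → (E →L[ℝ] E)) (L : ℝ) (hL : 0 < L)
    (hLip : ∀ x₁ x₂ : E, ‖J x₂ - J x₁‖ + ‖F x₂ - F x₁‖ ≤ L * ‖x₂ - x₁‖)
    (β γ M : ℝ) :
    ∃ C : ℝ, 0 < C ∧ ∀ (x y : E) (v u : Fin k → E), ‖x‖ ≤ M → ‖y‖ ≤ M → (∀ i, ‖v i‖ ≤ M) →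
      (∀ i, ‖u i‖ ≤ M) →
      ‖gX β (F x) v - gX β (F y) u‖ + ∑ i, ‖gB (γ • J x) v i - gB (γ • J y) u i‖
        ≤ C * (‖x - y‖ + ∑ i, ‖v i - u i‖) := by
  let ι := {p : (E × E) × ((Fin k → E) × (Fin k → E)) // ‖p.1.1‖ ≤ M ∧ ‖p.1.2‖ ≤ M ∧
    (∀ i, ‖p.2.1 i‖ ≤ M) ∧ (∀ i, ‖p.2.2 i‖ ≤ M)}
  let ε : ι → ℝ := fun p => ‖p.1.1.1 - p.1.1.2‖ + ∑ i, ‖p.1.2.1 i - p.1.2.2 i‖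
  have hε0 : ∀ p, 0 ≤ ε p := fun p =>
    add_nonneg (norm_nonneg _) (Finset.sum_nonneg fun i _ => norm_nonneg _)
  have hεx : ∀ p : ι, ‖p.1.1.1 - p.1.1.2‖ ≤ ε p := fun p =>
    le_add_of_nonneg_right (Finset.sum_nonneg fun i _ => norm_nonneg _)
  have hv : ∀ i, BL (⊤ : Filter ι) ε (fun p => p.1.2.1 i) (fun p => p.1.2.2 i) := fun i => by
    refine ⟨IsBigO.of_bound M (Eventually.of_forall fun p => ?_),
      IsBigO.of_bound M (Eventually.of_forall fun p => ?_),
      IsBigO.of_bound 1 (Eventually.of_forall fun p => ?_)⟩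
    · simpa using p.2.2.2.1 i
    · simpa using p.2.2.2.2 i
    · rw [Real.norm_of_nonneg (hε0 p), one_mul]
      have := Finset.single_le_sum (f := fun i => ‖p.1.2.1 i - p.1.2.2 i‖)
        (fun i _ => norm_nonneg _) (Finset.mem_univ i)
      have h2 := norm_nonneg (p.1.1.1 - p.1.1.2)
      simp only [ε]
      linarith
  have hFb : ∀ z, ‖z‖ ≤ M → ‖F z‖ ≤ ‖F 0‖ + L * M := fun z hz => by
    have h1 := hLip 0 z
    have h2 := norm_nonneg (J z - J 0)
    have h3 : ‖F z‖ ≤ ‖F 0‖ + ‖F z - F 0‖ := norm_le_insert' _ _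
    rw [sub_zero] at h1
    have h4 := mul_le_mul_of_nonneg_left hz hL.le
    linarith
  have hJb : ∀ z, ‖z‖ ≤ M → ‖J z‖ ≤ ‖J 0‖ + L * M := fun z hz => by
    have h1 := hLip 0 z
    have h2 := norm_nonneg (F z - F 0)
    have h3 : ‖J z‖ ≤ ‖J 0‖ + ‖J z - J 0‖ := norm_le_insert' _ _
    rw [sub_zero] at h1
    have h4 := mul_le_mul_of_nonneg_left hz hL.le
    linarith
  have hF : BL (⊤ : Filter ι) ε (fun p => F p.1.1.1) (fun p => F p.1.1.2) := by
    refine ⟨IsBigO.of_bound (‖F 0‖ + L * M) (Eventually.of_forall fun p => ?_),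
      IsBigO.of_bound (‖F 0‖ + L * M) (Eventually.of_forall fun p => ?_),
      IsBigO.of_bound L (Eventually.of_forall fun p => ?_)⟩
    · simpa using hFb _ p.2.1
    · simpa using hFb _ p.2.2.1
    · rw [Real.norm_of_nonneg (hε0 p)]
      have h1 := hLip p.1.1.2 p.1.1.1
      have h2 := norm_nonneg (J p.1.1.1 - J p.1.1.2)
      have h4 := mul_le_mul_of_nonneg_left (hεx p) hL.le
      linarith
  have hJ : BL (⊤ : Filter ι) ε (fun p => J p.1.1.1) (fun p => J p.1.1.2) := by
    refine ⟨IsBigO.of_bound (‖J 0‖ + L * M) (Eventually.of_forall fun p => ?_),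
      IsBigO.of_bound (‖J 0‖ + L * M) (Eventually.of_forall fun p => ?_),
      IsBigO.of_bound L (Eventually.of_forall fun p => ?_)⟩
    · simpa using hJb _ p.2.1
    · simpa using hJb _ p.2.2.1
    · rw [Real.norm_of_nonneg (hε0 p)]
      have h1 := hLip p.1.1.2 p.1.1.1
      have h2 := norm_nonneg (F p.1.1.1 - F p.1.1.2)
      have h4 := mul_le_mul_of_nonneg_left (hεx p) hL.le
      linarith
  have hB := hJ.const_smul γ
  have hGX : BL (⊤ : Filter ι) ε (fun p => gX β (F p.1.1.1) p.1.2.1)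
      (fun p => gX β (F p.1.1.2) p.1.2.2) :=
    (hF.sub ((BL.sum fun j => ((hv j).inner hF).smul (hv j)).const_smul 2)).const_smul β
  have hGB : ∀ i, BL (⊤ : Filter ι) ε (fun p => gB (γ • J p.1.1.1) p.1.2.1 i)
      (fun p => gB (γ • J p.1.1.2) p.1.2.2 i) := fun i =>
    (hB.clm (hv i)).add ((((hv i).inner (hB.clm (hv i))).neg.smul (hv i)).sub
      ((BL.sum fun j => ((hv j).inner (hB.clm (hv i))).smul (hv j)).const_smul 2))
  have hsum : (fun p : ι => ‖gX β (F p.1.1.1) p.1.2.1 - gX β (F p.1.1.2) p.1.2.2‖ +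
      ∑ i, ‖gB (γ • J p.1.1.1) p.1.2.1 i - gB (γ • J p.1.1.2) p.1.2.2 i‖) =O[⊤] ε :=
    hGX.2.2.norm_left.add (IsBigO.fun_sum fun i _ => (hGB i).2.2.norm_left)
  obtain ⟨C, hC0, hC⟩ := hsum.exists_pos
  rw [isBigOWith_top] at hC
  refine ⟨C, hC0, fun x y v u hx hy hv hu => ?_⟩
  have := hC ⟨((x, y), (v, u)), hx, hy, hv, hu⟩
  rw [Real.norm_of_nonneg (hε0 _)] at this
  exact (le_abs_self _).trans this

lemma gs_const (E : Type*) [NormedAddCommGroup E] [InnerProductSpace ℝ E] (k : ℕ) (K : ℝ) :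
    ∃ τ₀ : ℝ, 0 < τ₀ ∧ ∃ C : ℝ, 0 < C ∧ ∀ (τ : ℝ) (B : E →L[ℝ] E) (v v' : Fin k → E),
      0 < τ → τ ≤ τ₀ → ‖B‖ ≤ K → (∀ u w, ⟪B u, w⟫ = ⟪u, B w⟫) →
      (∀ i j, ⟪v i, v j⟫ = if i = j then (1:ℝ) else 0) →
      (∀ i, ‖v' i‖ = 1) →
      (∀ i, (v i + τ • B (v i)
          - ∑ j ∈ Finset.Iio i, ⟪v i + τ • B (v i), v' j⟫ • v' j)
        = ‖v i + τ • B (v i)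
          - ∑ j ∈ Finset.Iio i, ⟪v i + τ • B (v i), v' j⟫ • v' j‖ • v' i) →
      ∑ i, ‖v' i - v i - τ • gB B v i‖ ≤ C * τ ^ 2 := by
  let ι := {p : (ℝ × (E →L[ℝ] E)) × ((Fin k → E) × (Fin k → E)) // ‖p.1.2‖ ≤ K ∧
      (∀ u w, ⟪p.1.2 u, w⟫ = ⟪u, p.1.2 w⟫) ∧
      (∀ i j, ⟪p.2.1 i, p.2.1 j⟫ = if i = j then (1:ℝ) else 0) ∧
      (∀ i, ‖p.2.2 i‖ = 1) ∧
      (∀ i, (p.2.1 i + p.1.1 • p.1.2 (p.2.1 i)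
          - ∑ j ∈ Finset.Iio i, ⟪p.2.1 i + p.1.1 • p.1.2 (p.2.1 i), p.2.2 j⟫ • p.2.2 j)
        = ‖p.2.1 i + p.1.1 • p.1.2 (p.2.1 i)
          - ∑ j ∈ Finset.Iio i, ⟪p.2.1 i + p.1.1 • p.1.2 (p.2.1 i), p.2.2 j⟫ • p.2.2 j‖ • p.2.2 i)}
  let t : ι → ℝ := fun p => p.1.1.1
  have ht : Tendsto t (comap t (𝓝 0)) (𝓝 0) := tendsto_comap
  have h : (fun p : ι => ∑ i, ‖p.1.2.2 i - p.1.2.1 i - t p • gB p.1.1.2 p.1.2.1 i‖)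
      =O[comap t (𝓝 0)] (fun p => t p ^ 2) :=
    IsBigO.fun_sum fun i _ => (gs_step ht (K := K) (B := fun p => p.1.1.2)
      (v := fun p => p.1.2.1) (v' := fun p => p.1.2.2) (fun p => p.2.1) (fun p => p.2.2.1)
      (fun p => p.2.2.2.1) (fun p => p.2.2.2.2.1) (fun p => p.2.2.2.2.2) i).norm_left
  obtain ⟨C, hC0, hC⟩ := h.exists_pos
  have hC := hC.bound
  rw [eventually_comap, Metric.eventually_nhds_iff] at hC
  obtain ⟨δ, hδ, hC⟩ := hC
  refine ⟨δ / 2, by linarith, C, hC0, fun τ B v v' h1 h2 h3 h4 h5 h6 h7 => ?_⟩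
  have := hC (y := τ) (by rw [Real.dist_eq, sub_zero, abs_of_pos h1]; linarith)
    ⟨((τ, B), (v, v')), h3, h4, h5, h6, h7⟩ rfl
  rw [norm_pow, Real.norm_of_nonneg h1.le] at this
  exact (le_abs_self _).trans this

lemma gronwall {e : ℕ → ℝ} {a b : ℝ} (ha : 0 ≤ a) (hb : 0 ≤ b) (h0 : e 0 = 0) {N : ℕ}
    (h : ∀ n < N, e (n+1) ≤ (1 + a) * e n + b) : ∀ n ≤ N, e n ≤ n * b * (1 + a) ^ n := by
  intro n
  induction n with
  | zero => intro _; simp [h0]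
  | succ n ih =>
    intro hn
    have h1 := h n hn
    have h2 := mul_le_mul_of_nonneg_left (ih (by omega)) (by linarith : 0 ≤ 1 + a)
    have h3 : 1 ≤ (1 + a) ^ (n+1) := one_le_pow₀ (by linarith)
    have h4 := mul_le_mul_of_nonneg_left h3 hb
    push_cast
    calc e (n+1) ≤ (1+a) * (n * b * (1+a)^n) + b := by linarith
      _ ≤ (1+a) * (n * b * (1+a)^n) + b * (1+a)^(n+1) := by linarith
      _ = _ := by ring

lemma pow_bound {c τ T : ℝ} {n N : ℕ} (hc : 0 ≤ c) (hτ : 0 ≤ τ) (hn : n ≤ N)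
    (hT : N * τ = T) : (1 + c * τ) ^ n ≤ Real.exp (c * T) := by
  have h1 : 1 + c * τ ≤ Real.exp (c * τ) := by linarith [Real.add_one_le_exp (c * τ)]
  calc (1 + c * τ) ^ n ≤ Real.exp (c * τ) ^ n := pow_le_pow_left₀ (by positivity) h1 n
    _ = Real.exp (n * (c * τ)) := (Real.exp_nat_mul _ _).symm
    _ ≤ _ := by
      apply Real.exp_le_exp.2
      rw [← hT]
      have : (n:ℝ) ≤ N := by exact_mod_cast hn
      calc (n:ℝ) * (c * τ) ≤ N * (c * τ) := mul_le_mul_of_nonneg_right this (by positivity)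
        _ = _ := by ring

lemma gX_norm {k : ℕ} {β : ℝ} (hβ : 0 ≤ β) (f : E) {v : Fin k → E} (hv : ∀ i, ‖v i‖ = 1) :
    ‖gX β f v‖ ≤ β * (1 + 2 * k) * ‖f‖ := by
  have h1 : ‖∑ j, ⟪v j, f⟫ • v j‖ ≤ k * ‖f‖ := by
    refine (norm_sum_le _ _).trans ?_
    refine (Finset.sum_le_card_nsmul _ _ ‖f‖ fun j _ => ?_).trans (by simp)
    rw [norm_smul, hv, mul_one]
    simpa [hv] using norm_inner_le_norm (𝕜 := ℝ) (v j) f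
  rw [gX, norm_smul, Real.norm_of_nonneg hβ, mul_assoc]
  refine mul_le_mul_of_nonneg_left ?_ hβ
  refine (norm_sub_le _ _).trans ?_
  rw [norm_smul, Real.norm_of_nonneg (by norm_num)]
  linarith

end helpers

theorem hisd_stmt8
    (d k : ℕ) (hd : 1 ≤ d) (hk : 1 ≤ k) (hkd : k ≤ d)
    (F : EuclideanSpace ℝ (Fin d) → EuclideanSpace ℝ (Fin d))
    (J : EuclideanSpace ℝ (Fin d) → (EuclideanSpace ℝ (Fin d) →L[ℝ] EuclideanSpace ℝ (Fin d)))
    (hJsymm : ∀ x u w, ⟪J x u, w⟫ = ⟪u, J x w⟫)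
    (L : ℝ) (hL : 0 < L)
    (hLip : ∀ x₁ x₂ : EuclideanSpace ℝ (Fin d), ‖J x₂ - J x₁‖ + ‖F x₂ - F x₁‖ ≤ L * ‖x₂ - x₁‖)
    (hgrow : ∀ x : EuclideanSpace ℝ (Fin d), ‖F x‖ ≤ L * (1 + ‖x‖))
    (β γ : ℝ) (hβ : 0 < β) (hγ : 0 < γ)
    (T : ℝ) (hT : 0 < T)
    (x₀ : EuclideanSpace ℝ (Fin d))
    (v₀ : Fin k → EuclideanSpace ℝ (Fin d))
    (hv₀ : ∀ i j : Fin k, ⟪v₀ i, v₀ j⟫ = if i = j then (1:ℝ) else 0)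
    (X : ℝ → EuclideanSpace ℝ (Fin d)) (V : ℝ → Fin k → EuclideanSpace ℝ (Fin d))
    (hX0 : X 0 = x₀) (hV0 : V 0 = v₀)
    (hXreg : ContDiffOn ℝ 2 X (Set.Icc 0 T))
    (hVreg : ∀ i : Fin k, ContDiffOn ℝ 2 (fun t => V t i) (Set.Icc 0 T))
    (hXode : ∀ t ∈ Set.Icc (0:ℝ) T, HasDerivWithinAt X
        (β • (F (X t) - (2:ℝ) • ∑ j, ⟪V t j, F (X t)⟫ • V t j)) (Set.Icc 0 T) t)
    (hVode : ∀ t ∈ Set.Icc (0:ℝ) T, ∀ i : Fin k, HasDerivWithinAt (fun s => V s i)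
        (γ • J (X t) (V t i) + γ • ((-⟪V t i, J (X t) (V t i)⟫) • V t i -
          (2:ℝ) • ∑ j ∈ Finset.Iio i, ⟪V t j, J (X t) (V t i)⟫ • V t j)) (Set.Icc 0 T) t) :
    ∃ τ₀ > (0:ℝ), ∃ Q > (0:ℝ), ∀ (N : ℕ) (τ : ℝ), 0 < N → τ = T / N → τ ≤ τ₀ →
      ∀ (x : ℕ → EuclideanSpace ℝ (Fin d)) (v : ℕ → Fin k → EuclideanSpace ℝ (Fin d)),
        x 0 = x₀ → v 0 = v₀ →
        (∀ n < N, x (n+1) = x n + τ •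
            (β • (F (x n) - (2:ℝ) • ∑ j, ⟪v n j, F (x n)⟫ • v n j))) →
        (∀ n < N, ∀ i : Fin k,
          let vt := v n i + (τ * γ) • J (x n) (v n i)
          let w := vt - ∑ j ∈ Finset.Iio i, ⟪vt, v (n+1) j⟫ • v (n+1) j
          w ≠ 0 ∧ v (n+1) i = ‖w‖⁻¹ • w) →
        ∀ n : ℕ, 1 ≤ n → n ≤ N →
          ‖X (n * τ) - x n‖ + ∑ i, ‖V (n * τ) i - v n i‖ ≤ Q * τ := by
  -- bounds on the exact solution
  have hV0' : ∀ i, ContinuousOn (fun t => V t i) (Set.Icc 0 T) := fun i => (hVreg i).continuousOn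
  obtain ⟨MX, hMX⟩ := isCompact_Icc.exists_bound_of_continuousOn hXreg.continuousOn
  choose MV hMV using fun i => isCompact_Icc.exists_bound_of_continuousOn (hV0' i)
  -- bound on the iterates
  set c : ℝ := β * (1 + 2 * k) * L with hc
  have hc0 : 0 < c := by positivity
  set Mx : ℝ := Real.exp (c * T) * (1 + ‖x₀‖) with hMx
  have hMx0 : 0 < Mx := by positivity
  set M : ℝ := |MX| + ∑ i, |MV i| + Mx + 1 with hM
  have hMVs : 0 ≤ ∑ i, |MV i| := Finset.sum_nonneg fun i _ => abs_nonneg _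
  have hXM : ∀ t ∈ Set.Icc 0 T, ‖X t‖ ≤ M := fun t ht => by
    have := hMX t ht
    have := le_abs_self MX
    linarith
  have hVM : ∀ t ∈ Set.Icc 0 T, ∀ i, ‖V t i‖ ≤ M := fun t ht i => by
    have h1 := hMV i t ht
    have h2 := le_abs_self (MV i)
    have h3 := Finset.single_le_sum (f := fun i => |MV i|)
        (fun i _ => abs_nonneg _) (Finset.mem_univ i)
    have h4 := abs_nonneg MX
    linarith
  -- constants
  obtain ⟨C1, hC10, hC1⟩ := lip_const (k := k) F J L hL hLip β γ M
  obtain ⟨τ₀, hτ₀, C2, hC20, hC2⟩ := gs_const (EuclideanSpace ℝ (Fin d)) k (γ * (‖J 0‖ + L * M))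
  obtain ⟨CX, hCX0, hCX⟩ := taylor2 hT hXreg (f' := fun t => gX β (F (X t)) (V t)) hXode
  have hgBeq : ∀ (y : EuclideanSpace ℝ (Fin d)) (u : Fin k → EuclideanSpace ℝ (Fin d)) (i : Fin k),
      γ • J y (u i) + γ • ((-⟪u i, J y (u i)⟫) • u i -
          (2:ℝ) • ∑ j ∈ Finset.Iio i, ⟪u j, J y (u i)⟫ • u j) = gB (γ • J y) u i := by
    intro y u i
    have h1 : ∑ j ∈ Finset.Iio i, ⟪u j, γ • J y (u i)⟫ • u j
        = γ • ∑ j ∈ Finset.Iio i, ⟪u j, J y (u i)⟫ • u j := by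
      rw [Finset.smul_sum]
      refine Finset.sum_congr rfl fun j _ => ?_
      rw [real_inner_smul_right, mul_smul]
    simp only [gB, smul_apply]
    rw [h1, real_inner_smul_right]
    module
  have hVode' : ∀ i : Fin k, ∀ t ∈ Set.Icc (0:ℝ) T, HasDerivWithinAt (fun s => V s i)
      (gB (γ • J (X t)) (V t) i) (Set.Icc 0 T) t := fun i t ht => by
    rw [← hgBeq]; exact hVode t ht i
  choose CV hCV0 hCV using fun i => taylor2 hT (hVreg i) (hVode' i)
  set C3 : ℝ := CX + ∑ i, CV i + C2 with hC3
  have hC30 : 0 < C3 := by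
    have : 0 ≤ ∑ i, CV i := Finset.sum_nonneg fun i _ => hCV0 i
    linarith
  refine ⟨τ₀, hτ₀, T * C3 * Real.exp (C1 * T), by positivity, ?_⟩
  intro N τ hN hτN hττ₀ x v hx0 hv0 hxs hvs
  have hN' : (0:ℝ) < N := by exact_mod_cast hN
  have hτ : 0 < τ := by rw [hτN]; positivity
  have hNτ : N * τ = T := by rw [hτN]; field_simp
  have horth : ∀ n ≤ N, ∀ i j : Fin k, ⟪v n i, v n j⟫ = if i = j then (1:ℝ) else 0 := by
    intro n hn
    cases n with
    | zero => rw [hv0]; exact hv₀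
    | succ n => exact gs_orth (hvs n hn)
  have hnorm : ∀ n ≤ N, ∀ i, ‖v n i‖ = 1 := fun n hn i => by
    have := horth n hn i i
    rw [real_inner_self_eq_norm_sq] at this
    simp only [if_true] at this
    nlinarith [norm_nonneg (v n i)]
  have hxb : ∀ n ≤ N, 1 + ‖x n‖ ≤ (1 + c * τ) ^ n * (1 + ‖x₀‖) := by
    intro n
    induction n with
    | zero => intro _; simp [hx0]
    | succ n ih =>
      intro hn
      have h1 := ih (by omega)
      have h2 : ‖x (n+1)‖ ≤ ‖x n‖ + τ * ‖gX β (F (x n)) (v n)‖ := by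
        rw [hxs n hn]
        refine (norm_add_le _ _).trans ?_
        rw [norm_smul, Real.norm_of_nonneg hτ.le]
        rfl
      have h3 : ‖gX β (F (x n)) (v n)‖ ≤ c * (1 + ‖x n‖) := by
        refine (gX_norm hβ.le _ (hnorm n (by omega))).trans ?_
        rw [hc, mul_assoc _ L]
        exact mul_le_mul_of_nonneg_left (hgrow _) (by positivity)
      have h4 := mul_le_mul_of_nonneg_left h3 hτ.le
      have h5 := mul_le_mul_of_nonneg_left h1 (by positivity : 0 ≤ 1 + c * τ)
      calc 1 + ‖x (n+1)‖ ≤ (1 + c * τ) * (1 + ‖x n‖) := by linarith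
        _ ≤ _ := h5
        _ = _ := by ring
  have hxM : ∀ n ≤ N, ‖x n‖ ≤ M := fun n hn => by
    have h1 := hxb n hn
    have h2 := mul_le_mul_of_nonneg_right (pow_bound hc0.le hτ.le hn hNτ)
      (by positivity : 0 ≤ 1 + ‖x₀‖)
    have h4 := abs_nonneg MX
    linarith
  have hM1 : 1 ≤ M := by linarith [abs_nonneg MX]
  have hvM : ∀ n ≤ N, ∀ i, ‖v n i‖ ≤ M := fun n hn i => by rw [hnorm n hn]; exact hM1
  have hmem : ∀ n ≤ N, (n:ℝ) * τ ∈ Set.Icc 0 T := fun n hn => by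
    refine ⟨by positivity, ?_⟩
    rw [← hNτ]
    exact mul_le_mul_of_nonneg_right (by exact_mod_cast hn) hτ.le
  have hgs : ∀ n < N, ∑ i, ‖v (n+1) i - v n i - τ • gB (γ • J (x n)) (v n) i‖ ≤ C2 * τ ^ 2 := by
    intro n hn
    refine hC2 τ (γ • J (x n)) (v n) (v (n+1)) hτ hττ₀ ?_ ?_ (horth n hn.le) (hnorm _ hn) ?_
    · rw [norm_smul, Real.norm_of_nonneg hγ.le]
      refine mul_le_mul_of_nonneg_left ?_ hγ.le
      have h1 := hLip 0 (x n)
      have h2 := norm_nonneg (F (x n) - F 0)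
      have h3 : ‖J (x n)‖ ≤ ‖J 0‖ + ‖J (x n) - J 0‖ := norm_le_insert' _ _
      rw [sub_zero] at h1
      have h4 := mul_le_mul_of_nonneg_left (hxM n hn.le) hL.le
      linarith
    · intro u w
      simp only [smul_apply, real_inner_smul_left, real_inner_smul_right,
        hJsymm]
    · intro i
      obtain ⟨h1, h2⟩ := hvs n hn i
      simp only [mul_smul] at h1 h2
      simp only [smul_apply]
      conv_rhs => rw [h2]
      rw [smul_inv_smul₀ (norm_ne_zero_iff.2 h1)]
  have hstep : ∀ n < N,
      ‖X ((n+1 : ℕ) * τ) - x (n+1)‖ + ∑ i, ‖V ((n+1 : ℕ) * τ) i - v (n+1) i‖ ≤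
      (1 + C1 * τ) * (‖X (n * τ) - x n‖ + ∑ i, ‖V (n * τ) i - v n i‖) + C3 * τ ^ 2 := by
    intro n hn
    have ht := hmem n hn.le
    have hs := hmem (n+1) hn
    have hst : ((n+1 : ℕ):ℝ) * τ - n * τ = τ := by push_cast; ring
    have hle : (n:ℝ) * τ ≤ ((n+1 : ℕ):ℝ) * τ := by linarith
    have tX := hCX _ ht _ hs hle
    have tV := fun i => hCV i _ ht _ hs hle
    simp only [hst] at tX tV
    have hl := hC1 (X (n * τ)) (x n) (V (n * τ)) (v n) (hXM _ ht) (hxM n hn.le) (hVM _ ht)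
      (hvM n hn.le)
    have hg := hgs n hn
    generalize ((n+1 : ℕ):ℝ) * τ = s at *
    generalize (n:ℝ) * τ = t at *
    have eX : ‖X s - x (n+1)‖ ≤ CX * τ ^ 2 + ‖X t - x n‖ +
        τ * ‖gX β (F (X t)) (V t) - gX β (F (x n)) (v n)‖ := by
      have : X s - x (n+1) = (X s - X t - τ • gX β (F (X t)) (V t)) + (X t - x n)
          + τ • (gX β (F (X t)) (V t) - gX β (F (x n)) (v n)) := by
        rw [hxs n hn]
        simp only [gX]
        module
      rw [this]
      refine norm_add₃_le.trans ?_
      rw [norm_smul τ, Real.norm_of_nonneg hτ.le]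
      linarith
    have eV : ∀ i, ‖V s i - v (n+1) i‖ ≤ CV i * τ ^ 2 + ‖V t i - v n i‖ +
        τ * ‖gB (γ • J (X t)) (V t) i - gB (γ • J (x n)) (v n) i‖ +
        ‖v (n+1) i - v n i - τ • gB (γ • J (x n)) (v n) i‖ := by
      intro i
      have : V s i - v (n+1) i = (V s i - V t i - τ • gB (γ • J (X t)) (V t) i) + (V t i - v n i)
          + τ • (gB (γ • J (X t)) (V t) i - gB (γ • J (x n)) (v n) i)
          - (v (n+1) i - v n i - τ • gB (γ • J (x n)) (v n) i) := by
        module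
      rw [this]
      refine (norm_sub_le _ _).trans ?_
      refine add_le_add_left (norm_add₃_le.trans ?_) _
      rw [norm_smul τ, Real.norm_of_nonneg hτ.le]
      linarith [tV i]
    have eVs := Finset.sum_le_sum fun i (_ : i ∈ Finset.univ) => eV i
    simp only [Finset.sum_add_distrib, ← Finset.mul_sum, ← Finset.sum_mul] at eVs
    have hl' := mul_le_mul_of_nonneg_left hl hτ.le
    rw [hC3]
    linarith
  intro n _ hn
  have hfin := gronwall (e := fun n : ℕ => ‖X (n * τ) - x n‖ + ∑ i, ‖V (n * τ) i - v n i‖)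
    (a := C1 * τ) (b := C3 * τ ^ 2) (by positivity) (by positivity)
    (by simp [hx0, hv0, hX0, hV0]) hstep n hn
  have hp := pow_bound hC10.le hτ.le hn hNτ
  have hnT := (hmem n hn).2
  calc _ ≤ n * (C3 * τ ^ 2) * (1 + C1 * τ) ^ n := hfin
    _ = (n * τ) * (C3 * τ) * (1 + C1 * τ) ^ n := by ring
    _ ≤ T * (C3 * τ) * Real.exp (C1 * T) := by gcongr
    _ = _ := by ring
end
end

section
/- Under Assumption A, suppose the continuous HiSD system dx/dt = β(I − 2Σ_{j=1}^k v_j v_jᵀ)F(x), dv_i/dt = γ J(x) v_i + γ(−v_i v_iᵀ − 2Σ_{j=1}^{i−1} v_j v_jᵀ) J(x) v_i (1 ≤ i ≤ k) has a twice continuously differentiable solution on [0, T] with initial data x₀ and v_{i,0}. Let (x_n, v_{i,n}) be the iterates of the discrete HiSD scheme, and let (X_n, V_{i,n}) be the iterates of the modified scheme with the same initial data in which the directional update is replaced by Ṽ_{i,n} = V_{i,n−1} + τ γ J(X_{n−1}) V_{i,n−1} + τ γ(−V_{i,n−1} V_{i,n−1}ᵀ − 2Σ_{j=1}^{i−1}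 V_{j,n−1} V_{j,n−1}ᵀ) J(X_{n−1}) V_{i,n−1}, followed by the same Gram–Schmidt orthonormalization (and X_n = X_{n−1} + τ β(I − 2Σ_{j=1}^k V_{j,n−1}V_{j,n−1}ᵀ)F(X_{n−1})). Then there exist τ₀ > 0 and Q > 0 such that for every N with τ = T/N ≤ τ₀, ‖x_n − X_n‖ + Σ_{i=1}^k ‖v_{i,n} − V_{i,n}‖ ≤ Q τ for all 1 ≤ n ≤ N. -/
open scoped RealInnerProductSpace BigOperators

noncomputable section

section Helpers

variable {E : Type*} [NormedAddCommGroup E] [InnerProductSpace ℝ E] {k : ℕ}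

def gsB (u a : Fin k → E) (i : Fin k) : E :=
  a i - ⟪u i, a i⟫ • u i - ∑ j ∈ Finset.Iio i, (⟪u j, a i⟫ + ⟪u i, a j⟫) • u j

def IsGS (p v : Fin k → E) : Prop :=
  ∀ i, p i - ∑ j ∈ Finset.Iio i, ⟪p i, v j⟫ • v j ≠ 0 ∧
    v i = ‖p i - ∑ j ∈ Finset.Iio i, ⟪p i, v j⟫ • v j‖⁻¹ •
      (p i - ∑ j ∈ Finset.Iio i, ⟪p i, v j⟫ • v j)

def ON (v : Fin k → E) : Prop := ∀ i j, ⟪v i, v j⟫ = if i = j then (1:ℝ) else 0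

lemma ON.norm {v : Fin k → E} (h : ON v) (i : Fin k) : ‖v i‖ = 1 := by
  have := h i i
  rw [if_pos rfl, real_inner_self_eq_norm_sq] at this
  nlinarith [norm_nonneg (v i)]

lemma IsGS.on {p v : Fin k → E} (h : IsGS p v) : ON v := by
  have hn : ∀ i, ⟪v i, v i⟫ = 1 := by
    intro i
    obtain ⟨h0, h1⟩ := h i
    rw [real_inner_self_eq_norm_sq, h1, norm_smul, norm_inv, norm_norm,
      inv_mul_cancel₀ (norm_ne_zero_iff.mpr h0)]
    norm_num
  have ho : ∀ m : ℕ, ∀ i : Fin k, i.val < m → ∀ j < i, ⟪v i, v j⟫ = 0 := by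
    intro m
    induction m with
    | zero => intro i hi; omega
    | succ m ih =>
      intro i hi j hj
      rw [(h i).2, inner_smul_left, inner_sub_left, sum_inner]
      have hsum : ∑ l ∈ Finset.Iio i, ⟪⟪p i, v l⟫ • v l, v j⟫ = ⟪p i, v j⟫ := ?_
      · rw [hsum, sub_self, mul_zero]
      rw [Finset.sum_eq_single j]
      · rw [inner_smul_left, hn]; simp
      · intro l hl hlj
        rw [inner_smul_left]
        have hl' : l < i := by simpa using hl
        rcases lt_or_gt_of_ne hlj with h' | h'
        · rw [real_inner_comm (v j) (v l), ih j (by have : j.val < i.val := hj; omega) l h']; simp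
        · rw [ih l (by have : l.val < i.val := hl'; omega) j h']; simp
      · intro hh; exact absurd (Finset.mem_Iio.mpr hj) hh
  intro i j
  split_ifs with hij
  · subst hij; exact hn i
  · rcases lt_or_gt_of_ne hij with h' | h'
    · rw [real_inner_comm]; exact ho _ j (Nat.lt_succ_self _) i h'
    · exact ho _ i (Nat.lt_succ_self _) j h'

lemma abs_inner_le_of {x y : E} {a b : ℝ} (hx : ‖x‖ ≤ a) (hy : ‖y‖ ≤ b) : |⟪x, y⟫| ≤ a * b :=
  (abs_real_inner_le_norm x y).trans
    (mul_le_mul hx hy (norm_nonneg _) ((norm_nonneg _).trans hx))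

lemma norm_sum_Iio_le (i : Fin k) (f : Fin k → E) {c : ℝ} (hc : 0 ≤ c)
    (h : ∀ j < i, ‖f j‖ ≤ c) : ‖∑ j ∈ Finset.Iio i, f j‖ ≤ k * c := by
  calc ‖∑ j ∈ Finset.Iio i, f j‖ ≤ ∑ j ∈ Finset.Iio i, c :=
        norm_sum_le_of_le _ (fun j hj => h j (by simpa using hj))
    _ = (i.val : ℝ) * c := by simp
    _ ≤ k * c := by
        apply mul_le_mul_of_nonneg_right _ hc
        exact_mod_cast i.isLt.le

lemma gsB_norm {u a : Fin k → E} (hu : ON u) {M : ℝ} (hM : ∀ i, ‖a i‖ ≤ M) (i : Fin k) :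
    ‖gsB u a i‖ ≤ 2 * M + k * (2 * M) := by
  have hM0 : 0 ≤ M := (norm_nonneg _).trans (hM i)
  have h1 : ‖⟪u i, a i⟫ • u i‖ ≤ M := by
    rw [norm_smul, hu.norm, mul_one, Real.norm_eq_abs]
    simpa using abs_inner_le_of (hu.norm i).le (hM i)
  have h2 : ‖∑ j ∈ Finset.Iio i, (⟪u j, a i⟫ + ⟪u i, a j⟫) • u j‖ ≤ k * (2 * M) := by
    apply norm_sum_Iio_le _ _ (by linarith)
    intro j _
    rw [norm_smul, hu.norm, mul_one, Real.norm_eq_abs]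
    have h3 := abs_inner_le_of (hu.norm j).le (hM i)
    have h4 := abs_inner_le_of (hu.norm i).le (hM j)
    have h5 := abs_add_le ⟪u j, a i⟫ ⟪u i, a j⟫
    linarith
  unfold gsB
  have h3 := norm_sub_le (a i - ⟪u i, a i⟫ • u i)
    (∑ j ∈ Finset.Iio i, (⟪u j, a i⟫ + ⟪u i, a j⟫) • u j)
  have h4 := norm_sub_le (a i) (⟪u i, a i⟫ • u i)
  have := hM i
  linarith

lemma gsB_inner {u a : Fin k → E} (hu : ON u) {i j : Fin k} (hij : j ≤ i) :
    ⟪u i, gsB u a j⟫ = if i = j then 0 else ⟪u i, a j⟫ := by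
  unfold gsB
  rw [inner_sub_right, inner_sub_right, inner_sum, inner_smul_right, Finset.sum_eq_zero]
  · rw [hu i j]
    split_ifs with h
    · subst h; simp
    · simp
  · intro l hl
    have hl' : l < j := by simpa using hl
    rw [inner_smul_right, hu i l, if_neg (by intro h; subst h; exact absurd hij (not_le.mpr hl'))]
    simp

lemma normalize_bound {u b w : E} {α τ B M K : ℝ} (hu : ‖u‖ = 1) (hub : ⟪u, b⟫ = 0)
    (hb : ‖b‖ ≤ B) (hα : |α| ≤ M) (hw : ‖w - (1 + τ * α) • (u + τ • b)‖ ≤ K * τ ^ 2)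
    (hτ : 0 ≤ τ) (hτ1 : τ ≤ 1) (hMτ : M * τ ≤ 1 / 4) (hK : K * τ ^ 2 ≤ 1 / 4) :
    ‖‖w‖⁻¹ • w - (u + τ • b)‖ ≤ 2 * (K + (K + (1 + M) * B ^ 2) * (1 + B)) * τ ^ 2 := by
  have hB : 0 ≤ B := (norm_nonneg _).trans hb
  have hM : 0 ≤ M := (abs_nonneg _).trans hα
  set z := u + τ • b with hz
  have hz2 : ‖z‖ ^ 2 = 1 + τ ^ 2 * ‖b‖ ^ 2 := by
    rw [hz, norm_add_sq_real, inner_smul_right, hub, hu, norm_smul, Real.norm_eq_abs, abs_of_nonneg hτ]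
    ring
  have hb2 : ‖b‖ ^ 2 ≤ B ^ 2 := by gcongr
  have hz1 : 1 ≤ ‖z‖ := by nlinarith [norm_nonneg z, mul_nonneg (sq_nonneg τ) (sq_nonneg ‖b‖)]
  have hz3 : ‖z‖ - 1 ≤ B ^ 2 * τ ^ 2 := by nlinarith [sq_nonneg τ, mul_le_mul_of_nonneg_left hb2 (sq_nonneg τ)]
  have hz4 : ‖z‖ ≤ 1 + B := by
    have : ‖z‖ ≤ ‖u‖ + ‖τ • b‖ := norm_add_le _ _
    rw [norm_smul, Real.norm_eq_abs, abs_of_nonneg hτ, hu] at this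
    nlinarith [norm_nonneg b]
  obtain ⟨ha1, ha2⟩ := abs_le.mp hα
  set s := 1 + τ * α with hs
  have hs1 : 3 / 4 ≤ s := by nlinarith
  have hs2 : s ≤ 1 + M := by nlinarith
  have hsz : ‖s • z‖ = s * ‖z‖ := by rw [norm_smul, Real.norm_eq_abs, abs_of_nonneg (by linarith)]
  have h1 : |‖w‖ - s * ‖z‖| ≤ K * τ ^ 2 := by
    rw [← hsz]; exact (abs_norm_sub_norm_le _ _).trans hw
  obtain ⟨h1a, h1b⟩ := abs_le.mp h1
  have hw2 : 1 / 2 ≤ ‖w‖ := by nlinarith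
  have h5 : s * (‖z‖ - 1) ≤ (1 + M) * (B ^ 2 * τ ^ 2) :=
    mul_le_mul hs2 hz3 (by linarith) (by linarith)
  have h5' : 0 ≤ s * (‖z‖ - 1) := mul_nonneg (by linarith) (by linarith)
  have h2 : |s - ‖w‖| ≤ (K + (1 + M) * B ^ 2) * τ ^ 2 := by
    rw [abs_le]; constructor <;> nlinarith
  have h3 : ‖w - ‖w‖ • z‖ ≤ (K + (K + (1 + M) * B ^ 2) * (1 + B)) * τ ^ 2 := by
    have : w - ‖w‖ • z = (w - s • z) + (s - ‖w‖) • z := by module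
    rw [this]
    have h6 := norm_add_le (w - s • z) ((s - ‖w‖) • z)
    have h7 : ‖(s - ‖w‖) • z‖ ≤ (K + (1 + M) * B ^ 2) * τ ^ 2 * (1 + B) := by
      rw [norm_smul, Real.norm_eq_abs]
      exact mul_le_mul h2 hz4 (norm_nonneg _) ((abs_nonneg _).trans h2)
    linarith
  have h8 : ‖w‖⁻¹ • w - z = ‖w‖⁻¹ • (w - ‖w‖ • z) := by
    rw [smul_sub, smul_smul, inv_mul_cancel₀ (by linarith), one_smul]
  have h9 : ‖w‖⁻¹ ≤ 2 := by
    rw [inv_le_comm₀ (by linarith) (by norm_num)]; linarith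
  rw [h8, norm_smul, norm_inv, norm_norm]
  calc _ ≤ 2 * ((K + (K + (1 + M) * B ^ 2) * (1 + B)) * τ ^ 2) :=
        mul_le_mul h9 h3 (norm_nonneg _) (by norm_num)
    _ = _ := by ring

set_option maxHeartbeats 2000000 in
lemma gs_step_s9 (k : ℕ) (M : ℝ) (hM : 0 ≤ M) (m : ℕ) :
    ∃ C : ℝ, 0 ≤ C ∧ ∃ τ₀ > (0:ℝ), ∀ (τ : ℝ) (u a v : Fin k → E), 0 ≤ τ → τ ≤ τ₀ → ON u →
      (∀ i, ‖a i‖ ≤ M) → IsGS (fun i => u i + τ • a i) v →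
      ∀ i : Fin k, i.val < m → ‖v i - (u i + τ • gsB u a i)‖ ≤ C * τ ^ 2 := by
  induction m with
  | zero => exact ⟨0, le_rfl, 1, one_pos, fun τ u a v _ _ _ _ _ i hi => absurd hi (by omega)⟩
  | succ m ih =>
    obtain ⟨C, hC, τ₀, hτ₀, H⟩ := ih
    set B : ℝ := 2 * M + k * (2 * M) with hBdef
    have hB : 0 ≤ B := by positivity
    set K1 : ℝ := M * B + (1 + M) * C with hK1
    set K2 : ℝ := K1 + 2 * M * (B + C) with hK2
    set K : ℝ := k * K2 + M * B with hK
    have hK10 : 0 ≤ K1 := by positivity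
    have hK20 : 0 ≤ K2 := by positivity
    have hK0 : 0 ≤ K := by positivity
    refine ⟨2 * (K + (K + (1 + M) * B ^ 2) * (1 + B)), by positivity,
      min τ₀ (1 / (4 * (1 + M + K))), by positivity, ?_⟩
    intro τ u a v hτ hττ hu ha hv i hi
    have hτa : τ ≤ τ₀ := hττ.trans (min_le_left _ _)
    have hτb : τ ≤ 1 / (4 * (1 + M + K)) := hττ.trans (min_le_right _ _)
    rw [le_div_iff₀ (by positivity)] at hτb
    have hMτ0 : 0 ≤ τ * M := by positivity
    have hKτ0 : 0 ≤ τ * K := by positivity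
    have hτ1 : τ ≤ 1 := by nlinarith
    have hMτ : M * τ ≤ 1 / 4 := by nlinarith
    have hKτ : K * τ ^ 2 ≤ 1 / 4 := by
      have : K * τ ^ 2 ≤ K * τ := by nlinarith
      nlinarith
    have hvn := hv.on
    have Hj : ∀ j < i, ‖v j - (u j + τ • gsB u a j)‖ ≤ C * τ ^ 2 := fun j hj =>
      H τ u a v hτ hτa hu ha hv j (by have : j.val < i.val := hj; omega)
    have hτ2 : τ ^ 2 ≤ τ := by nlinarith
    rw [(hv i).2]
    have hbi := gsB_norm hu ha
    refine normalize_bound (α := ⟪u i, a i⟫) (hu.norm i) ?_ (hbi i) ?_ ?_ hτ hτ1 hMτ hKτ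
    · rw [gsB_inner hu le_rfl, if_pos rfl]
    · simpa using abs_inner_le_of (hu.norm i).le (ha i)
    · have hterm : ∀ j < i, ‖⟪u i + τ • a i, v j⟫ • v j -
          (τ * (⟪u j, a i⟫ + ⟪u i, a j⟫)) • u j‖ ≤ K2 * τ ^ 2 := by
        intro j hj
        set r := v j - (u j + τ • gsB u a j) with hr
        have hvj : v j = u j + τ • gsB u a j + r := by rw [hr]; abel
        have e1 : ⟪u i + τ • a i, v j⟫ - τ * (⟪u j, a i⟫ + ⟪u i, a j⟫)
            = τ ^ 2 * ⟪a i, gsB u a j⟫ + ⟪u i + τ • a i, r⟫ := by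
          conv_lhs => rw [hvj, inner_add_right]
          simp only [inner_add_left, inner_add_right, inner_smul_left, inner_smul_right]
          rw [gsB_inner hu hj.le, if_neg hj.ne', hu i j, if_neg hj.ne', real_inner_comm (u j) (a i)]
          simp
          ring
        have e2 : |⟪u i + τ • a i, v j⟫ - τ * (⟪u j, a i⟫ + ⟪u i, a j⟫)| ≤ K1 * τ ^ 2 := by
          rw [e1]
          have f1 := abs_inner_le_of (ha i) (hbi j)
          have f0 : ‖u i + τ • a i‖ ≤ 1 + M := by
            refine (norm_add_le _ _).trans ?_
            rw [norm_smul, Real.norm_eq_abs, abs_of_nonneg hτ, hu.norm]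
            nlinarith [ha i, norm_nonneg (a i)]
          have f2 := abs_inner_le_of f0 (Hj j hj)
          refine (abs_add_le _ _).trans ?_
          rw [abs_mul, abs_of_nonneg (sq_nonneg τ)]
          have f3 := mul_le_mul_of_nonneg_left f1 (sq_nonneg τ)
          rw [hK1]
          linarith
        have e3 : ‖v j - u j‖ ≤ (B + C) * τ := by
          have : v j - u j = τ • gsB u a j + r := by rw [hr]; abel
          rw [this]
          refine (norm_add_le _ _).trans ?_
          rw [norm_smul, Real.norm_eq_abs, abs_of_nonneg hτ]
          nlinarith [hbi j, Hj j hj, mul_le_mul_of_nonneg_left hτ2 hC,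
            mul_le_mul_of_nonneg_left (hbi j) hτ]
        have e4 : |τ * (⟪u j, a i⟫ + ⟪u i, a j⟫)| ≤ τ * (2 * M) := by
          rw [abs_mul, abs_of_nonneg hτ]
          have h3 := abs_inner_le_of (hu.norm j).le (ha i)
          have h4 := abs_inner_le_of (hu.norm i).le (ha j)
          have h5 := abs_add_le ⟪u j, a i⟫ ⟪u i, a j⟫
          exact mul_le_mul_of_nonneg_left (by linarith) hτ
        have e5 : ⟪u i + τ • a i, v j⟫ • v j - (τ * (⟪u j, a i⟫ + ⟪u i, a j⟫)) • u j
            = (⟪u i + τ • a i, v j⟫ - τ * (⟪u j, a i⟫ + ⟪u i, a j⟫)) • v j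
              + (τ * (⟪u j, a i⟫ + ⟪u i, a j⟫)) • (v j - u j) := by module
        rw [e5]
        refine (norm_add_le _ _).trans ?_
        rw [norm_smul, norm_smul, hvn.norm, mul_one, Real.norm_eq_abs, Real.norm_eq_abs]
        have e6 := mul_le_mul e4 e3 (norm_nonneg _) (by positivity)
        rw [hK2]
        nlinarith
      have hsum := norm_sum_Iio_le i _ (by positivity) hterm
      have e7 : (u i + τ • a i - ∑ j ∈ Finset.Iio i, ⟪u i + τ • a i, v j⟫ • v j)
          - (1 + τ * ⟪u i, a i⟫) • (u i + τ • gsB u a i)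
          = -(∑ j ∈ Finset.Iio i, (⟪u i + τ • a i, v j⟫ • v j -
          (τ * (⟪u j, a i⟫ + ⟪u i, a j⟫)) • u j)) - (τ ^ 2 * ⟪u i, a i⟫) • gsB u a i := by
        rw [Finset.sum_sub_distrib]
        simp only [mul_smul, ← Finset.smul_sum]
        have : a i = gsB u a i + ⟪u i, a i⟫ • u i +
            ∑ j ∈ Finset.Iio i, (⟪u j, a i⟫ + ⟪u i, a j⟫) • u j := by
          unfold gsB; abel
        generalize gsB u a i = g at this ⊢
        generalize (∑ j ∈ Finset.Iio i, ⟪u i + τ • a i, v j⟫ • v j) = S1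
        generalize (∑ j ∈ Finset.Iio i, (⟪u j, a i⟫ + ⟪u i, a j⟫) • u j) = S2 at this ⊢
        generalize ⟪u i, a i⟫ = al at this ⊢
        rw [this]
        module
      simp only []
      rw [e7]
      refine (norm_sub_le _ _).trans ?_
      rw [norm_neg, norm_smul, Real.norm_eq_abs, abs_mul, abs_of_nonneg (sq_nonneg τ)]
      have g1 : |⟪u i, a i⟫| ≤ M := by simpa using abs_inner_le_of (hu.norm i).le (ha i)
      have g2 := mul_le_mul g1 (hbi i) (norm_nonneg _) hM
      have g3 := mul_le_mul_of_nonneg_left g2 (sq_nonneg τ)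
      rw [hK]
      linarith

/-- directional field -/
def dirG (γ : ℝ) (A : E →L[ℝ] E) (u : Fin k → E) (i : Fin k) : E :=
  γ • A (u i) + γ • ((-⟪u i, A (u i)⟫) • u i - (2:ℝ) • ∑ j ∈ Finset.Iio i, ⟪u j, A (u i)⟫ • u j)

lemma gsB_J (γ : ℝ) (A : E →L[ℝ] E) (hA : ∀ u w, ⟪A u, w⟫ = ⟪u, A w⟫) (u : Fin k → E) (i : Fin k) :
    gsB u (fun i => γ • A (u i)) i = dirG γ A u i := by
  unfold gsB dirG
  have : ∑ j ∈ Finset.Iio i, (⟪u j, γ • A (u i)⟫ + ⟪u i, γ • A (u j)⟫) • u j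
      = (γ * 2) • ∑ j ∈ Finset.Iio i, ⟪u j, A (u i)⟫ • u j := by
    rw [Finset.smul_sum]
    refine Finset.sum_congr rfl fun j _ => ?_
    rw [inner_smul_right, inner_smul_right, ← hA (u i) (u j), real_inner_comm (u j) (A (u i)),
      smul_smul]
    congr 1; ring
  rw [this, inner_smul_right]
  module

lemma gsB_dirG (γ : ℝ) (A : E →L[ℝ] E) (hA : ∀ u w, ⟪A u, w⟫ = ⟪u, A w⟫) (u : Fin k → E)
    (hu : ON u) (i : Fin k) : gsB u (dirG γ A u) i = dirG γ A u i := by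
  have e1 : ∀ i j, j ≤ i → ⟪u i, dirG γ A u j⟫ = if i = j then 0 else γ * ⟪u i, A (u j)⟫ := by
    intro i j hij
    rw [← gsB_J γ A hA, gsB_inner hu hij, inner_smul_right]
  have e2 : ∀ i j, j < i → ⟪u j, dirG γ A u i⟫ = - (γ * ⟪u i, A (u j)⟫) := by
    intro i j hij
    have : ⟪u j, ∑ l ∈ Finset.Iio i, ⟪u l, A (u i)⟫ • u l⟫ = ⟪u j, A (u i)⟫ := by
      rw [inner_sum, Finset.sum_eq_single j]
      · rw [inner_smul_right, hu j j]; simp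
      · intro l _ hl
        rw [inner_smul_right, hu j l, if_neg hl.symm, mul_zero]
      · intro hh; exact absurd (Finset.mem_Iio.mpr hij) hh
    unfold dirG
    simp only [inner_add_right, inner_sub_right, inner_smul_right]
    rw [this, hu j i, if_neg hij.ne, ← hA (u i) (u j), real_inner_comm (u j) (A (u i))]
    ring
  unfold gsB
  rw [e1 i i le_rfl, if_pos rfl, Finset.sum_eq_zero]
  · simp
  · intro j hj
    have hj' : j < i := by simpa using hj
    rw [e2 i j hj', e1 i j hj'.le, if_neg hj'.ne']
    simp

lemma proj_lip {u U f g : E} {c : ℝ} (hu : ‖u‖ = 1) (hU : ‖U‖ = 1) (hf : ‖f‖ ≤ c) (hg : ‖g‖ ≤ c) :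
    ‖⟪u, f⟫ • u - ⟪U, g⟫ • U‖ ≤ 2 * c * ‖u - U‖ + ‖f - g‖ := by
  have e : ⟪u, f⟫ • u - ⟪U, g⟫ • U
      = (⟪u - U, f⟫ + ⟪U, f - g⟫) • u + ⟪U, g⟫ • (u - U) := by
    rw [inner_sub_left, inner_sub_right]; module
  rw [e]
  refine (norm_add_le _ _).trans ?_
  rw [norm_smul, norm_smul, hu, Real.norm_eq_abs, Real.norm_eq_abs, mul_one]
  have h1 := abs_add_le ⟪u - U, f⟫ ⟪U, f - g⟫
  have h2 := abs_inner_le_of (le_refl ‖u - U‖) hf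
  have h3 := abs_inner_le_of hU.le (le_refl ‖f - g‖)
  have h4 := mul_le_mul_of_nonneg_right (abs_inner_le_of hU.le hg) (norm_nonneg (u - U))
  linarith

lemma norm_proj {u f : E} (hu : ‖u‖ = 1) : ‖⟪u, f⟫ • u‖ ≤ ‖f‖ := by
  rw [norm_smul, hu, mul_one, Real.norm_eq_abs]
  simpa using abs_inner_le_of hu.le (le_refl ‖f‖)

lemma dirG_norm {γ c : ℝ} (hγ : 0 ≤ γ) {A : E →L[ℝ] E} (hA : ‖A‖ ≤ c) {u : Fin k → E} (hu : ON u)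
    (i : Fin k) : ‖dirG γ A u i‖ ≤ γ * (c * (2 + 2 * k)) := by
  have h0 : ‖A (u i)‖ ≤ c := by
    refine (A.le_opNorm _).trans ?_
    rw [hu.norm, mul_one]; exact hA
  have hc : 0 ≤ c := (norm_nonneg _).trans h0
  have h1 := norm_proj (f := A (u i)) (hu.norm i)
  have h2 := norm_sum_Iio_le i (fun j => ⟪u j, A (u i)⟫ • u j) hc
    (fun j _ => (norm_proj (hu.norm j)).trans h0)
  unfold dirG
  rw [← smul_add, norm_smul, Real.norm_eq_abs, abs_of_nonneg hγ]
  apply mul_le_mul_of_nonneg_left _ hγ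
  refine (norm_add_le _ _).trans ?_
  have h3 := norm_sub_le ((-⟪u i, A (u i)⟫) • u i) ((2:ℝ) • ∑ j ∈ Finset.Iio i, ⟪u j, A (u i)⟫ • u j)
  rw [neg_smul, norm_neg, norm_smul (2:ℝ), Real.norm_eq_abs, abs_of_nonneg (by norm_num : (0:ℝ) ≤ 2)] at h3
  rw [neg_smul]
  linarith

lemma dirG_lip {γ c δA D : ℝ} (hγ : 0 ≤ γ) {A A' : E →L[ℝ] E} (hA : ‖A‖ ≤ c) (hA' : ‖A'‖ ≤ c)
    (hAA : ‖A - A'‖ ≤ δA) {u U : Fin k → E} (hu : ON u) (hU : ON U)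
    (hD : ∀ i, ‖u i - U i‖ ≤ D) (i : Fin k) :
    ‖dirG γ A u i - dirG γ A' U i‖ ≤ γ * ((2 + 2 * k) * (δA + 3 * c * D)) := by
  have hb : ∀ {A : E →L[ℝ] E} {u : Fin k → E}, ‖A‖ ≤ c → ON u → ‖A (u i)‖ ≤ c := by
    intro A u hA hu
    refine (A.le_opNorm _).trans ?_
    rw [hu.norm, mul_one]; exact hA
  have h0 := hb hA hu
  have h0' := hb hA' hU
  have hc : 0 ≤ c := (norm_nonneg _).trans h0
  have hD0 : 0 ≤ D := (norm_nonneg _).trans (hD i)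
  have hδ0 : 0 ≤ δA := (norm_nonneg _).trans hAA
  have hcD : 0 ≤ c * D := mul_nonneg hc hD0
  have h1 : ‖A (u i) - A' (U i)‖ ≤ δA + c * D := by
    have : A (u i) - A' (U i) = (A - A') (u i) + A' (u i - U i) := by
      rw [sub_apply, map_sub]; abel
    rw [this]
    refine (norm_add_le _ _).trans ?_
    have g1 := (A - A').le_opNorm (u i)
    rw [hu.norm, mul_one] at g1
    have g2 := (A'.le_opNorm (u i - U i)).trans
      (mul_le_mul hA' (hD i) (norm_nonneg _) hc)
    linarith
  have hp : ∀ j, ‖⟪u j, A (u i)⟫ • u j - ⟪U j, A' (U i)⟫ • U j‖ ≤ δA + 3 * c * D := by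
    intro j
    have g := proj_lip (hu.norm j) (hU.norm j) h0 h0'
    have g2 := mul_le_mul_of_nonneg_left (hD j) hc
    linarith
  have hs := norm_sum_Iio_le i (fun j => ⟪u j, A (u i)⟫ • u j - ⟪U j, A' (U i)⟫ • U j)
    (by nlinarith) (fun j _ => hp j)
  have e : dirG γ A u i - dirG γ A' U i = γ • ((A (u i) - A' (U i))
      - (⟪u i, A (u i)⟫ • u i - ⟪U i, A' (U i)⟫ • U i)
      - (2:ℝ) • ∑ j ∈ Finset.Iio i, (⟪u j, A (u i)⟫ • u j - ⟪U j, A' (U i)⟫ • U j)) := by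
    unfold dirG
    rw [Finset.sum_sub_distrib]; module
  rw [e, norm_smul, Real.norm_eq_abs, abs_of_nonneg hγ]
  apply mul_le_mul_of_nonneg_left _ hγ
  refine (norm_sub_le _ _).trans ?_
  rw [norm_smul (2:ℝ), Real.norm_eq_abs, abs_of_nonneg (by norm_num : (0:ℝ) ≤ 2)]
  have g1 := norm_sub_le (A (u i) - A' (U i)) (⟪u i, A (u i)⟫ • u i - ⟪U i, A' (U i)⟫ • U i)
  have g2 := hp i
  linarith

def posS (f : E) (u : Fin k → E) : E := f - (2:ℝ) • ∑ j, ⟪u j, f⟫ • u j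

lemma posS_norm {f : E} {u : Fin k → E} (hu : ON u) : ‖posS f u‖ ≤ (1 + 2 * k) * ‖f‖ := by
  unfold posS
  refine (norm_sub_le _ _).trans ?_
  rw [norm_smul (2:ℝ), Real.norm_eq_abs, abs_of_nonneg (by norm_num : (0:ℝ) ≤ 2)]
  have : ‖∑ j, ⟪u j, f⟫ • u j‖ ≤ ∑ j : Fin k, ‖f‖ :=
    norm_sum_le_of_le _ (fun j _ => norm_proj (hu.norm j))
  simp at this
  linarith

lemma posS_lip {f g : E} {c D : ℝ} (hf : ‖f‖ ≤ c) (hg : ‖g‖ ≤ c) {u U : Fin k → E}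
    (hu : ON u) (hU : ON U) (hD : ∀ i, ‖u i - U i‖ ≤ D) :
    ‖posS f u - posS g U‖ ≤ (1 + 2 * k) * ‖f - g‖ + 4 * k * c * D := by
  have e : posS f u - posS g U = (f - g) - (2:ℝ) • ∑ j, (⟪u j, f⟫ • u j - ⟪U j, g⟫ • U j) := by
    unfold posS
    rw [Finset.sum_sub_distrib]; module
  rw [e]
  refine (norm_sub_le _ _).trans ?_
  rw [norm_smul (2:ℝ), Real.norm_eq_abs, abs_of_nonneg (by norm_num : (0:ℝ) ≤ 2)]
  have hc : 0 ≤ c := (norm_nonneg _).trans hf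
  have : ‖∑ j, (⟪u j, f⟫ • u j - ⟪U j, g⟫ • U j)‖ ≤ ∑ j : Fin k, (2 * c * D + ‖f - g‖) :=
    norm_sum_le_of_le _ (fun j _ => (proj_lip (hu.norm j) (hU.norm j) hf hg).trans (by
      have := mul_le_mul_of_nonneg_left (hD j) hc
      linarith))
  rw [Finset.sum_const, Finset.card_univ, Fintype.card_fin, nsmul_eq_mul] at this
  linarith

lemma pow_le_exp_aux {A T τ : ℝ} {N n : ℕ} (hA : 0 ≤ A) (hT : 0 < T) (hN : 0 < N) (hτ : τ = T / N)
    (hn : n ≤ N) : (1 + A * τ) ^ n ≤ Real.exp (A * T) := by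
  have hN' : (0:ℝ) < N := by exact_mod_cast hN
  have hτ0 : 0 < τ := by rw [hτ]; positivity
  have h1 : 1 + A * τ ≤ Real.exp (A * τ) := by
    have := Real.add_one_le_exp (A * τ); linarith
  have h2 : n * τ ≤ T := by
    have : (N:ℝ) * τ = T := by rw [hτ]; field_simp
    rw [← this]
    exact mul_le_mul_of_nonneg_right (by exact_mod_cast hn) hτ0.le
  calc (1 + A * τ) ^ n ≤ Real.exp (A * τ) ^ n := by
        apply pow_le_pow_left₀ (by positivity) h1
    _ = Real.exp (A * (n * τ)) := by rw [← Real.exp_nat_mul]; ring_nf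
    _ ≤ _ := Real.exp_le_exp.mpr (mul_le_mul_of_nonneg_left h2 hA)

lemma pos_bound {F : E → E} {L β T τ : ℝ} {N : ℕ} (hL : 0 < L) (hβ : 0 < β) (hT : 0 < T)
    (hN : 0 < N) (hτ : τ = T / N) (hgrow : ∀ x, ‖F x‖ ≤ L * (1 + ‖x‖)) {x : ℕ → E}
    {v : ℕ → Fin k → E} (hv : ∀ n ≤ N, ON (v n))
    (hx : ∀ n < N, x (n+1) = x n + τ • (β • posS (F (x n)) (v n))) :
    ∀ n ≤ N, ‖x n‖ ≤ (1 + ‖x 0‖) * Real.exp (β * ((1 + 2 * k) * L) * T) := by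
  have hτ0 : 0 < τ := by rw [hτ]; positivity
  have key : ∀ n ≤ N, 1 + ‖x n‖ ≤ (1 + ‖x 0‖) * (1 + β * ((1 + 2 * k) * L) * τ) ^ n := by
    intro n
    induction n with
    | zero => simp
    | succ n ih =>
      intro hn
      have ih := ih (by omega)
      rw [hx n (by omega), pow_succ, ← mul_assoc]
      refine le_trans ?_ (mul_le_mul_of_nonneg_right ih (by positivity))
      have h1 := norm_add_le (x n) (τ • (β • posS (F (x n)) (v n)))
      rw [norm_smul, norm_smul, Real.norm_eq_abs, Real.norm_eq_abs, abs_of_pos hτ0, abs_of_pos hβ] at h1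
      have h2 : ‖posS (F (x n)) (v n)‖ ≤ (1 + 2 * k) * (L * (1 + ‖x n‖)) :=
        (posS_norm (hv n (by omega))).trans
          (mul_le_mul_of_nonneg_left (hgrow _) (by positivity))
      have h3 : τ * (β * ‖posS (F (x n)) (v n)‖) ≤ τ * (β * ((1 + 2 * k) * (L * (1 + ‖x n‖)))) := by
        gcongr
      linarith
  intro n hn
  have h1 := key n hn
  have h2 := mul_le_mul_of_nonneg_left
    (pow_le_exp_aux (A := β * ((1 + 2 * k) * L)) (by positivity) hT hN hτ hn)
    (by positivity : 0 ≤ 1 + ‖x 0‖)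
  linarith

lemma gronwall_aux {A B τ : ℝ} (hA : 0 ≤ A) (hB : 0 ≤ B) (hτ : 0 ≤ τ) {N : ℕ} {δ : ℕ → ℝ}
    (h0 : δ 0 = 0) (h : ∀ n < N, δ (n+1) ≤ (1 + A * τ) * δ n + B * τ ^ 2) :
    ∀ n ≤ N, δ n ≤ n * (B * τ ^ 2) * (1 + A * τ) ^ n := by
  intro n
  induction n with
  | zero => simp [h0]
  | succ n ih =>
    intro hn
    have h1 := h n (by omega)
    have h2 := mul_le_mul_of_nonneg_left (ih (by omega)) (by positivity : 0 ≤ 1 + A * τ)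
    have h3 : 1 ≤ (1 + A * τ) ^ (n+1) := one_le_pow₀ (by nlinarith [mul_nonneg hA hτ])
    have h4 := mul_le_mul_of_nonneg_left h3 (by positivity : 0 ≤ B * τ ^ 2)
    have h5 : (1 + A * τ) * (n * (B * τ ^ 2) * (1 + A * τ) ^ n)
        = n * (B * τ ^ 2) * (1 + A * τ) ^ (n+1) := by ring
    push_cast
    rw [h5] at h2
    linarith

end Helpers

theorem hisd_stmt9
    (d k : ℕ) (hd : 1 ≤ d) (hk : 1 ≤ k) (hkd : k ≤ d)
    (F : EuclideanSpace ℝ (Fin d) → EuclideanSpace ℝ (Fin d))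
    (J : EuclideanSpace ℝ (Fin d) → (EuclideanSpace ℝ (Fin d) →L[ℝ] EuclideanSpace ℝ (Fin d)))
    (hJsymm : ∀ x u w, ⟪J x u, w⟫ = ⟪u, J x w⟫)
    (L : ℝ) (hL : 0 < L)
    (hLip : ∀ x₁ x₂ : EuclideanSpace ℝ (Fin d), ‖J x₂ - J x₁‖ + ‖F x₂ - F x₁‖ ≤ L * ‖x₂ - x₁‖)
    (hgrow : ∀ x : EuclideanSpace ℝ (Fin d), ‖F x‖ ≤ L * (1 + ‖x‖))
    (β γ : ℝ) (hβ : 0 < β) (hγ : 0 < γ)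
    (T : ℝ) (hT : 0 < T)
    (x₀ : EuclideanSpace ℝ (Fin d))
    (v₀ : Fin k → EuclideanSpace ℝ (Fin d))
    (hv₀ : ∀ i j : Fin k, ⟪v₀ i, v₀ j⟫ = if i = j then (1:ℝ) else 0)
    (hsol : ∃ (X : ℝ → EuclideanSpace ℝ (Fin d)) (V : ℝ → Fin k → EuclideanSpace ℝ (Fin d)),
      X 0 = x₀ ∧ V 0 = v₀ ∧
      ContDiffOn ℝ 2 X (Set.Icc 0 T) ∧
      (∀ i : Fin k, ContDiffOn ℝ 2 (fun t => V t i) (Set.Icc 0 T)) ∧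
      (∀ t ∈ Set.Icc (0:ℝ) T, HasDerivWithinAt X
        (β • (F (X t) - (2:ℝ) • ∑ j, ⟪V t j, F (X t)⟫ • V t j)) (Set.Icc 0 T) t) ∧
      (∀ t ∈ Set.Icc (0:ℝ) T, ∀ i : Fin k, HasDerivWithinAt (fun s => V s i)
        (γ • J (X t) (V t i) + γ • ((-⟪V t i, J (X t) (V t i)⟫) • V t i -
          (2:ℝ) • ∑ j ∈ Finset.Iio i, ⟪V t j, J (X t) (V t i)⟫ • V t j)) (Set.Icc 0 T) t)) :
    ∃ τ₀ > (0:ℝ), ∃ Q > (0:ℝ), ∀ (N : ℕ) (τ : ℝ), 0 < N → τ = T / N → τ ≤ τ₀ →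
      ∀ (x : ℕ → EuclideanSpace ℝ (Fin d)) (v : ℕ → Fin k → EuclideanSpace ℝ (Fin d)),
        x 0 = x₀ → v 0 = v₀ →
        (∀ n < N, x (n+1) = x n + τ •
            (β • (F (x n) - (2:ℝ) • ∑ j, ⟪v n j, F (x n)⟫ • v n j))) →
        (∀ n < N, ∀ i : Fin k,
          let vt := v n i + (τ * γ) • J (x n) (v n i)
          let w := vt - ∑ j ∈ Finset.Iio i, ⟪vt, v (n+1) j⟫ • v (n+1) j
          w ≠ 0 ∧ v (n+1) i = ‖w‖⁻¹ • w) →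
      ∀ (X : ℕ → EuclideanSpace ℝ (Fin d)) (V : ℕ → Fin k → EuclideanSpace ℝ (Fin d)),
        X 0 = x₀ → V 0 = v₀ →
        (∀ n < N, X (n+1) = X n + τ •
            (β • (F (X n) - (2:ℝ) • ∑ j, ⟪V n j, F (X n)⟫ • V n j))) →
        (∀ n < N, ∀ i : Fin k,
          let Vt := V n i + (τ * γ) • J (X n) (V n i) +
            (τ * γ) • ((-⟪V n i, J (X n) (V n i)⟫) • V n i -
              (2:ℝ) • ∑ j ∈ Finset.Iio i, ⟪V n j, J (X n) (V n i)⟫ • V n j)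
          let w := Vt - ∑ j ∈ Finset.Iio i, ⟪Vt, V (n+1) j⟫ • V (n+1) j
          w ≠ 0 ∧ V (n+1) i = ‖w‖⁻¹ • w) →
        ∀ n : ℕ, 1 ≤ n → n ≤ N →
          ‖x n - X n‖ + ∑ i, ‖v n i - V n i‖ ≤ Q * τ := by
  -- The ODE solution is not needed: the two schemes agree to second order in each step.
  clear hsol
  set R : ℝ := (1 + ‖x₀‖) * Real.exp (β * ((1 + 2 * k) * L) * T) with hR
  have hR0 : 0 ≤ R := by positivity
  set cF : ℝ := L * (1 + R) with hcF
  set cJ : ℝ := ‖J 0‖ + L * R with hcJ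
  have hcF0 : 0 ≤ cF := by positivity
  have hcJ0 : 0 ≤ cJ := by positivity
  set M : ℝ := γ * (cJ * (2 + 2 * k)) with hM
  have hM0 : 0 ≤ M := by positivity
  obtain ⟨C, hC, τ₀, hτ₀, H⟩ := gs_step_s9 (E := EuclideanSpace ℝ (Fin d)) k M hM0 k
  set A1 : ℝ := β * ((1 + 2 * k) * L + 4 * k * cF) with hA1
  set A2 : ℝ := γ * ((2 + 2 * k) * (L + 3 * cJ)) with hA2
  set A : ℝ := A1 + k * A2 with hA
  set B : ℝ := k * (2 * C) with hB
  have hA10 : 0 ≤ A1 := by positivity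
  have hA20 : 0 ≤ A2 := by positivity
  have hA0 : 0 ≤ A := by positivity
  have hB0 : 0 ≤ B := by positivity
  refine ⟨τ₀, hτ₀, T * B * Real.exp (A * T) + 1, by positivity, ?_⟩
  intro N τ hN hτ hττ x v hx0 hv0 hx hv X V hX0 hV0 hX hV n _ hnN
  have hτ0 : 0 < τ := by rw [hτ]; positivity
  have hv' : ∀ n < N, IsGS (fun i => v n i + τ • (γ • J (x n) (v n i))) (v (n+1)) := by
    intro n hn i
    have := hv n hn i
    simp only [mul_smul] at this
    exact this
  have hV' : ∀ n < N, IsGS (fun i => V n i + τ • dirG γ (J (X n)) (V n) i) (V (n+1)) := by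
    intro n hn i
    have := hV n hn i
    have e : V n i + τ • dirG γ (J (X n)) (V n) i = V n i + (τ * γ) • J (X n) (V n i) +
            (τ * γ) • ((-⟪V n i, J (X n) (V n i)⟫) • V n i -
              (2:ℝ) • ∑ j ∈ Finset.Iio i, ⟪V n j, J (X n) (V n i)⟫ • V n j) := by
      unfold dirG; module
    simp only [e]
    exact this
  have hvon : ∀ n ≤ N, ON (v n) := by
    intro n hn
    cases n with
    | zero => rw [hv0]; exact hv₀
    | succ n => exact (hv' n (by omega)).on
  have hVon : ∀ n ≤ N, ON (V n) := by
    intro n hn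
    cases n with
    | zero => rw [hV0]; exact hv₀
    | succ n => exact (hV' n (by omega)).on
  have hxR : ∀ n ≤ N, ‖x n‖ ≤ R := by
    have := pos_bound hL hβ hT hN hτ hgrow hvon hx
    rw [hx0] at this; exact this
  have hXR : ∀ n ≤ N, ‖X n‖ ≤ R := by
    have := pos_bound hL hβ hT hN hτ hgrow hVon hX
    rw [hX0] at this; exact this
  have hFb : ∀ y, ‖y‖ ≤ R → ‖F y‖ ≤ cF := fun y hy =>
    (hgrow y).trans (mul_le_mul_of_nonneg_left (by linarith) hL.le)
  have hJb : ∀ y, ‖y‖ ≤ R → ‖J y‖ ≤ cJ := by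
    intro y hy
    have h1 := hLip 0 y
    rw [sub_zero] at h1
    have h2 := norm_sub_norm_le (J y) (J 0)
    have h3 := norm_nonneg (F y - F 0)
    have h4 := mul_le_mul_of_nonneg_left hy hL.le
    linarith
  have step : ∀ n < N, (fun n => ‖x n - X n‖ + ∑ i, ‖v n i - V n i‖) (n+1) ≤
      (1 + A * τ) * (fun n => ‖x n - X n‖ + ∑ i, ‖v n i - V n i‖) n + B * τ ^ 2 := by
    intro n hn
    beta_reduce
    set D := ‖x n - X n‖ + ∑ i, ‖v n i - V n i‖ with hD
    have hs0 : 0 ≤ ∑ i, ‖v n i - V n i‖ := Finset.sum_nonneg fun i _ => norm_nonneg _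
    have hxD : ‖x n - X n‖ ≤ D := by linarith
    have hvD : ∀ i, ‖v n i - V n i‖ ≤ D := by
      intro i
      have := Finset.single_le_sum (f := fun i => ‖v n i - V n i‖) (fun i _ => norm_nonneg _)
        (Finset.mem_univ i)
      have h2 := norm_nonneg (x n - X n)
      linarith
    have hD0 : 0 ≤ D := (norm_nonneg _).trans hxD
    have o1 := hvon n hn.le
    have o2 := hVon n hn.le
    have b1 := hxR n hn.le
    have b2 := hXR n hn.le
    have hl := hLip (X n) (x n)
    have hlD := mul_le_mul_of_nonneg_left hxD hL.le
    have hlF : ‖F (x n) - F (X n)‖ ≤ L * D := by linarith [norm_nonneg (J (x n) - J (X n))]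
    have hlJ : ‖J (x n) - J (X n)‖ ≤ L * D := by linarith [norm_nonneg (F (x n) - F (X n))]
    -- position
    have px : ‖x (n+1) - X (n+1)‖ ≤ ‖x n - X n‖ + τ * (A1 * D) := by
      have e : x (n+1) - X (n+1) = (x n - X n) +
          τ • (β • (posS (F (x n)) (v n) - posS (F (X n)) (V n))) := by
        rw [hx n hn, hX n hn]; unfold posS; module
      rw [e]
      refine (norm_add_le _ _).trans ?_
      rw [norm_smul, norm_smul, Real.norm_eq_abs, Real.norm_eq_abs, abs_of_pos hτ0, abs_of_pos hβ]
      have q := posS_lip (hFb _ b1) (hFb _ b2) o1 o2 hvD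
      have q2 : ‖posS (F (x n)) (v n) - posS (F (X n)) (V n)‖ ≤
          ((1 + 2 * k) * L + 4 * k * cF) * D := by
        have := mul_le_mul_of_nonneg_left hlF (by positivity : (0:ℝ) ≤ 1 + 2 * k)
        linarith
      have q3 := mul_le_mul_of_nonneg_left (mul_le_mul_of_nonneg_left q2 hβ.le) hτ0.le
      rw [hA1]
      linarith
    have pv : ∀ i, ‖v (n+1) i - V (n+1) i‖ ≤ ‖v n i - V n i‖ + (τ * (A2 * D) + 2 * C * τ ^ 2) := by
      intro i
      have g1 := H τ (v n) (fun i => γ • J (x n) (v n i)) (v (n+1)) hτ0.le hττ o1 (by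
        intro i
        rw [norm_smul, Real.norm_eq_abs, abs_of_pos hγ, hM]
        apply mul_le_mul_of_nonneg_left _ hγ.le
        have h1 := (J (x n)).le_opNorm (v n i)
        rw [o1.norm, mul_one] at h1
        have h2 := hJb _ b1
        have h3 : 0 ≤ cJ * (1 + 2 * k) := by positivity
        linarith) (hv' n hn) i i.isLt
      have g2 := H τ (V n) (dirG γ (J (X n)) (V n)) (V (n+1)) hτ0.le hττ o2
        (dirG_norm hγ.le (hJb _ b2) o2) (hV' n hn) i i.isLt
      rw [gsB_J γ _ (hJsymm _)] at g1
      rw [gsB_dirG γ _ (hJsymm _) _ o2] at g2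
      have g3 := dirG_lip hγ.le (hJb _ b1) (hJb _ b2) hlJ o1 o2 hvD i
      have e : v (n+1) i - V (n+1) i = (v n i - V n i) +
          τ • (dirG γ (J (x n)) (v n) i - dirG γ (J (X n)) (V n) i) +
          ((v (n+1) i - (v n i + τ • dirG γ (J (x n)) (v n) i)) -
           (V (n+1) i - (V n i + τ • dirG γ (J (X n)) (V n) i))) := by module
      rw [e]
      refine (norm_add₃_le).trans ?_
      have g4 := norm_sub_le (v (n+1) i - (v n i + τ • dirG γ (J (x n)) (v n) i))
           (V (n+1) i - (V n i + τ • dirG γ (J (X n)) (V n) i))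
      rw [norm_smul, Real.norm_eq_abs, abs_of_pos hτ0]
      have g5 := mul_le_mul_of_nonneg_left g3 hτ0.le
      rw [hA2]
      linarith
    have ps := Finset.sum_le_sum (s := Finset.univ) fun i _ => pv i
    rw [Finset.sum_add_distrib] at ps
    simp only [Finset.sum_const, Finset.card_univ, Fintype.card_fin, nsmul_eq_mul] at ps
    rw [hA, hB]
    linarith
  have hg := gronwall_aux (δ := fun n => ‖x n - X n‖ + ∑ i, ‖v n i - V n i‖)
    hA0 hB0 hτ0.le (by simp [hx0, hX0, hv0, hV0]) step n hnN
  refine hg.trans ?_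
  have h1 := pow_le_exp_aux hA0 hT hN hτ hnN
  have hN' : (0:ℝ) < N := by exact_mod_cast hN
  have h2 : n * τ ≤ T := by
    have : (N:ℝ) * τ = T := by rw [hτ]; field_simp
    rw [← this]
    exact mul_le_mul_of_nonneg_right (by exact_mod_cast hnN) hτ0.le
  calc (n:ℝ) * (B * τ ^ 2) * (1 + A * τ) ^ n = (n * τ) * (B * τ) * (1 + A * τ) ^ n := by ring
    _ ≤ T * (B * τ) * Real.exp (A * T) := by gcongr
    _ ≤ _ := by nlinarith
end
end

section
/- Under Assumption A, suppose the continuous constrained HiSD system on the unit sphere, dx/dt = (I − 2Σ_{j=1}^k v_j v_jᵀ)F(x) − x xᵀ F(x), dv_i/dt = J(x) v_i + (−v_i v_iᵀ − 2Σ_{j=1}^{i−1} v_j v_jᵀ) J(x) v_i − x xᵀ J(x) v_i + x (v_iᵀ F(x)) for 1 ≤ i ≤ k, has a twice continuously differentiable solution (x(t), v_1(t), …, v_k(t)) on [0, T] with x(0) = x₀ and v_i(0) = v_{i,0}. Then there exist τ₀ > 0 and Q > 0, independent of τ, n and N, such that for every N ∈ ℕ with τ = T/N ≤ τ₀, the iterates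 of the constrained discrete HiSD scheme satisfy, with t_n = nτ, ‖x_n − x(t_n)‖ + Σ_{i=1}^k ‖v_{i,n} − v_i(t_n)‖ ≤ Q τ for all 1 ≤ n ≤ N. -/
open scoped RealInnerProductSpace BigOperators

noncomputable section

open Filter Asymptotics Topology

/-- `w = u + τ b + O(τ²)` with `u, b` bounded, along the filter `l`. -/
structure HisdEx {ι : Type*} {E : Type*} [NormedAddCommGroup E] [NormedSpace ℝ E]
    (l : Filter ι) (τ : ι → ℝ) (u b w : ι → E) : Prop where
  bu : u =O[l] (fun _ => (1:ℝ))
  bb : b =O[l] (fun _ => (1:ℝ))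
  ex : (fun p => w p - u p - τ p • b p) =O[l] (fun p => τ p ^ 2)

namespace HisdEx

variable {ι : Type*} {l : Filter ι} {τ : ι → ℝ}

section normed
variable {E : Type*} [NormedAddCommGroup E] [NormedSpace ℝ E]
  {u b w u' b' w' : ι → E}

theorem tau_O1 (hτ : Tendsto τ l (𝓝 0)) : τ =O[l] (fun _ => (1:ℝ)) :=
  hτ.isBigO_one ℝ

theorem mk_exact (hu : u =O[l] (fun _ => (1:ℝ))) (hb : b =O[l] (fun _ => (1:ℝ))) :
    HisdEx l τ u b (fun p => u p + τ p • b p) :=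
  ⟨hu, hb, by
    have : (fun p => u p + τ p • b p - u p - τ p • b p) = fun _ => (0:E) := by
      funext p; abel
    rw [this]; exact isBigO_zero _ _⟩

theorem add (h : HisdEx l τ u b w) (h' : HisdEx l τ u' b' w') :
    HisdEx l τ (fun p => u p + u' p) (fun p => b p + b' p) (fun p => w p + w' p) :=
  ⟨h.bu.add h'.bu, h.bb.add h'.bb, by
    refine (h.ex.add h'.ex).congr_left fun p => ?_
    simp only [smul_add]; abel⟩

theorem sub (h : HisdEx l τ u b w) (h' : HisdEx l τ u' b' w') :
    HisdEx l τ (fun p => u p - u' p) (fun p => b p - b' p) (fun p => w p - w' p) :=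
  ⟨h.bu.sub h'.bu, h.bb.sub h'.bb, by
    refine (h.ex.sub h'.ex).congr_left fun p => ?_
    simp only [smul_sub]; abel⟩

theorem sum {κ : Type*} (s : Finset κ) {u b w : κ → ι → E}
    (h : ∀ j ∈ s, HisdEx l τ (u j) (b j) (w j)) :
    HisdEx l τ (fun p => ∑ j ∈ s, u j p) (fun p => ∑ j ∈ s, b j p)
      (fun p => ∑ j ∈ s, w j p) :=
  ⟨IsBigO.fun_sum fun j hj => (h j hj).bu, IsBigO.fun_sum fun j hj => (h j hj).bb, by
    refine (IsBigO.fun_sum fun j hj => (h j hj).ex).congr_left fun p => ?_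
    simp only [Finset.sum_sub_distrib, Finset.smul_sum]⟩

theorem congr (h : HisdEx l τ u b w) (h1 : ∀ p, u p = u' p) (h2 : ∀ p, b p = b' p)
    (h3 : ∀ p, w p = w' p) : HisdEx l τ u' b' w' := by
  rw [← funext h1, ← funext h2, ← funext h3]; exact h

theorem first (hτ : Tendsto τ l (𝓝 0)) (h : HisdEx l τ u b w) :
    (fun p => w p - u p) =O[l] τ := by
  have h1 : (fun p => τ p ^ 2) =O[l] τ := by
    have := (tau_O1 hτ).mul (isBigO_refl τ l)
    simpa [sq] using this
  have h2 : (fun p => τ p • b p) =O[l] τ := by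
    have := (isBigO_refl τ l).smul h.bb
    simpa using this
  refine ((h.ex.trans h1).add h2).congr_left fun p => ?_
  abel

theorem O1 (hτ : Tendsto τ l (𝓝 0)) (h : HisdEx l τ u b w) :
    w =O[l] (fun _ => (1:ℝ)) := by
  refine (((h.first hτ).trans (tau_O1 hτ)).add h.bu).congr_left fun p => ?_
  abel

/-- a general bilinear product rule -/
theorem bilin {E' G : Type*} [NormedAddCommGroup E'] [NormedSpace ℝ E']
    [NormedAddCommGroup G] [NormedSpace ℝ G] (hτ : Tendsto τ l (𝓝 0))
    (m : E →L[ℝ] E' →L[ℝ] G) {u' b' w' : ι → E'}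
    (h : HisdEx l τ u b w) (h' : HisdEx l τ u' b' w') :
    HisdEx l τ (fun p => m (u p) (u' p)) (fun p => m (u p) (b' p) + m (b p) (u' p))
      (fun p => m (w p) (w' p)) := by
  have key : ∀ {f : ι → E} {g : ι → E'} {α β : ι → ℝ}, f =O[l] α → g =O[l] β →
      (fun p => m (f p) (g p)) =O[l] (fun p => α p * β p) := by
    intro f g α β hf hg
    have h0 : (fun p => m (f p) (g p)) =O[l] (fun p => ‖f p‖ * ‖g p‖) := by
      refine IsBigO.of_bound ‖m‖ (Eventually.of_forall fun p => ?_)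
      have := m.le_opNorm₂ (f p) (g p)
      rw [Real.norm_of_nonneg (by positivity)]
      linarith
    exact h0.trans (hf.norm_left.mul hg.norm_left)
  refine ⟨?_, ?_, ?_⟩
  · simpa using key h.bu h'.bu
  · have h1 := key h.bu h'.bb
    have h2 := key h.bb h'.bu
    simpa using h1.add h2
  · have h1 := key h.bu h'.ex
    have h2 := key h.ex h'.bu
    have h3 := key (h.first hτ) (h'.first hτ)
    simp only [one_mul, mul_one, ← sq] at h1 h2 h3
    refine ((h1.add h2).add h3).congr_left fun p => ?_
    simp only [map_sub, map_smul, sub_apply, smul_apply,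
      smul_add]
    abel

theorem smul (hτ : Tendsto τ l (𝓝 0)) {c0 c1 c : ι → ℝ} (hc : HisdEx l τ c0 c1 c)
    (h : HisdEx l τ u b w) :
    HisdEx l τ (fun p => c0 p • u p) (fun p => c0 p • b p + c1 p • u p)
      (fun p => c p • w p) := by
  simpa using hc.bilin hτ (ContinuousLinearMap.lsmul ℝ ℝ) h

end normed

section inner
variable {E : Type*} [NormedAddCommGroup E] [InnerProductSpace ℝ E]
  {u b w u' b' w' : ι → E}

theorem inner (hτ : Tendsto τ l (𝓝 0)) (h : HisdEx l τ u b w) (h' : HisdEx l τ u' b' w') :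
    HisdEx l τ (fun p => ⟪u p, u' p⟫) (fun p => ⟪u p, b' p⟫ + ⟪b p, u' p⟫)
      (fun p => ⟪w p, w' p⟫) := by
  exact h.bilin hτ (innerSL ℝ) h'

theorem invNorm (hτ : Tendsto τ l (𝓝 0)) (h : HisdEx l τ u b w) (hu : ∀ p, ‖u p‖ = 1) :
    HisdEx l τ (fun _ => (1:ℝ)) (fun p => - ⟪u p, b p⟫) (fun p => ‖w p‖⁻¹) := by
  have hin := h.inner hτ h
  have ha : (fun p => ⟪u p, b p⟫) =O[l] (fun _ => (1:ℝ)) := by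
    refine (hin.bb.const_mul_left (1/2)).congr_left fun p => ?_
    rw [real_inner_comm (u p) (b p)]; ring
  -- s - 1 = O(τ)
  have hs1 : (fun p => ‖w p‖ - 1) =O[l] τ := by
    refine IsBigO.trans ?_ (h.first hτ)
    refine IsBigO.of_bound 1 (Eventually.of_forall fun p => ?_)
    rw [one_mul, ← hu p]
    exact abs_norm_sub_norm_le _ _
  have hs2 : (fun p => ‖w p‖ - 1 - τ p * ⟪u p, b p⟫) =O[l] (fun p => τ p ^ 2) := by
    have h1 := hs1.mul hs1
    simp only [← sq] at h1
    refine ((hin.ex.sub h1).const_mul_left (1/2)).congr_left fun p => ?_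
    simp only [real_inner_self_eq_norm_sq, hu p, smul_eq_mul]
    rw [real_inner_comm (u p) (b p)]; ring
  have hlim : Tendsto (fun p => ‖w p‖) l (𝓝 1) := by
    have h0 : Tendsto (fun p => ‖w p‖ - 1) l (𝓝 0) := hs1.trans_tendsto hτ
    simpa using h0.add_const 1
  have hinv : (fun p => ‖w p‖⁻¹) =O[l] (fun _ => (1:ℝ)) :=
    (hlim.inv₀ one_ne_zero).isBigO_one ℝ
  refine ⟨isBigO_refl _ _, ha.neg_left, ?_⟩
  have h3 : (fun p => τ p * ⟪u p, b p⟫ * (‖w p‖ - 1)) =O[l] (fun p => τ p ^ 2) := by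
    have := ((isBigO_refl τ l).mul ha).mul hs1
    simpa [sq] using this
  have h4 := (h3.sub hs2).mul hinv
  simp only [mul_one] at h4
  refine h4.congr' ?_ EventuallyEq.rfl
  have hev : ∀ᶠ p in l, ‖w p‖ ≠ 0 := hlim.eventually_ne one_ne_zero
  filter_upwards [hev] with p hp
  simp only [smul_eq_mul]
  field_simp
  ring

theorem normalize (hτ : Tendsto τ l (𝓝 0)) (h : HisdEx l τ u b w) (hu : ∀ p, ‖u p‖ = 1) :
    HisdEx l τ u (fun p => b p - ⟪u p, b p⟫ • u p) (fun p => ‖w p‖⁻¹ • w p) := by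
  refine ((h.invNorm hτ hu).smul hτ h).congr ?_ ?_ (fun _ => rfl)
  · intro p; simp
  · intro p; simp [sub_eq_add_neg]

end inner
end HisdEx

section euler
variable {Z : Type*} [NormedAddCommGroup Z] [NormedSpace ℝ Z]

theorem hisd_euler (Φ : Z → Z) (K M T C : ℝ) (hK : 0 ≤ K) (hT : 0 < T) (hC : 0 ≤ C)
    (hM : 0 ≤ M)
    (hLip : ∀ a b : Z, ‖a‖ ≤ M → ‖b‖ ≤ M → ‖Φ a - Φ b‖ ≤ K * ‖a - b‖)
    (Y : ℝ → Z) (hYM : ∀ t ∈ Set.Icc (0:ℝ) T, ‖Y t‖ ≤ M)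
    (hY : ∀ t ∈ Set.Icc (0:ℝ) T, HasDerivWithinAt Y (Φ (Y t)) (Set.Icc 0 T) t) :
    ∃ Q > (0:ℝ), ∀ (N : ℕ) (τ : ℝ), 0 < N → τ = T / N →
      ∀ y : ℕ → Z, y 0 = Y 0 → (∀ n ≤ N, ‖y n‖ ≤ M) →
        (∀ n < N, ‖y (n+1) - y n - τ • Φ (y n)‖ ≤ C * τ ^ 2) →
        ∀ n ≤ N, ‖y n - Y (n * τ)‖ ≤ Q * τ := by
  set B := ‖Φ 0‖ + K * M with hB
  have hB0 : 0 ≤ B := by positivity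
  have hΦB : ∀ t ∈ Set.Icc (0:ℝ) T, ‖Φ (Y t)‖ ≤ B := by
    intro t ht
    have h1 := hLip (Y t) 0 (hYM t ht) (by simpa using hM)
    have h2 : ‖Φ (Y t)‖ ≤ ‖Φ (Y t) - Φ 0‖ + ‖Φ 0‖ := by
      simpa using norm_add_le (Φ (Y t) - Φ 0) (Φ 0)
    have h3 := mul_le_mul_of_nonneg_left (hYM t ht) hK
    simp only [sub_zero] at h1
    linarith
  have hYlip : ∀ s ∈ Set.Icc (0:ℝ) T, ∀ t ∈ Set.Icc (0:ℝ) T, ‖Y t - Y s‖ ≤ B * ‖t - s‖ := by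
    intro s hs t ht
    exact (convex_Icc 0 T).norm_image_sub_le_of_norm_hasDerivWithin_le hY hΦB hs ht
  have htrunc : ∀ t τ : ℝ, 0 ≤ t → 0 ≤ τ → t + τ ≤ T →
      ‖Y (t + τ) - Y t - τ • Φ (Y t)‖ ≤ K * B * τ ^ 2 := by
    intro t τ ht hτ htT
    have hsub : Set.Icc t (t + τ) ⊆ Set.Icc 0 T := Set.Icc_subset_Icc ht htT
    have htI : t ∈ Set.Icc (0:ℝ) T := ⟨ht, by linarith⟩
    have hd : ∀ s ∈ Set.Icc t (t + τ), HasDerivWithinAt (fun s => Y s - s • Φ (Y t))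
        (Φ (Y s) - (1:ℝ) • Φ (Y t)) (Set.Icc t (t + τ)) s := by
      intro s hs
      exact ((hY s (hsub hs)).mono hsub).sub ((hasDerivWithinAt_id s _).smul_const _)
    have hb : ∀ s ∈ Set.Icc t (t + τ), ‖Φ (Y s) - (1:ℝ) • Φ (Y t)‖ ≤ K * B * τ := by
      intro s hs
      rw [one_smul]
      have h1 := hLip (Y s) (Y t) (hYM s (hsub hs)) (hYM t htI)
      have h2 := hYlip t htI s (hsub hs)
      have h3 : ‖s - t‖ ≤ τ := by
        rw [Real.norm_eq_abs, abs_le]; constructor <;> linarith [hs.1, hs.2]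
      calc _ ≤ K * ‖Y s - Y t‖ := h1
        _ ≤ K * (B * τ) := by gcongr; exact h2.trans (by gcongr)
        _ = _ := by ring
    have := (convex_Icc t (t+τ)).norm_image_sub_le_of_norm_hasDerivWithin_le hd hb
      (Set.left_mem_Icc.2 (by linarith)) (Set.right_mem_Icc.2 (by linarith))
    have e : Y (t + τ) - (t + τ) • Φ (Y t) - (Y t - t • Φ (Y t))
        = Y (t + τ) - Y t - τ • Φ (Y t) := by
      rw [add_smul]; abel
    simp only [e, add_sub_cancel_left] at this
    rw [Real.norm_of_nonneg hτ] at this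
    linarith
  set D := K * B + C with hD
  have hD0 : 0 ≤ D := by positivity
  refine ⟨D * T * Real.exp (K * T) + 1, by positivity, ?_⟩
  intro N τ hN hτ y hy0 hyM hstep
  have hNr : (0:ℝ) < N := by exact_mod_cast hN
  have hτ0 : 0 < τ := by rw [hτ]; positivity
  have hNτ : N * τ = T := by rw [hτ]; field_simp
  have main : ∀ n ≤ N, ‖y n - Y (n * τ)‖ ≤ n * τ ^ 2 * D * (1 + K * τ) ^ n := by
    intro n
    induction n with
    | zero => intro _; simp [hy0]
    | succ n ih =>
      intro hn
      have ih := ih (by omega)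
      have hnN : ((n:ℝ) + 1) * τ ≤ T := by
        rw [← hNτ]; gcongr; exact_mod_cast hn
      have hnτ : 0 ≤ (n:ℝ) * τ := by positivity
      have h1 := hstep n (by omega)
      have h2 := htrunc (n * τ) τ hnτ hτ0.le (by linarith)
      have h3 := hLip (y n) (Y (n * τ)) (hyM n (by omega)) (hYM _ ⟨hnτ, by linarith⟩)
      have e1 : ((n + 1 : ℕ) : ℝ) * τ = n * τ + τ := by push_cast; ring
      rw [e1]
      have e2 : y (n+1) - Y (n * τ + τ) = (y (n+1) - y n - τ • Φ (y n))
          - (Y (n * τ + τ) - Y (n * τ) - τ • Φ (Y (n * τ)))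
          + ((y n - Y (n * τ)) + τ • (Φ (y n) - Φ (Y (n * τ)))) := by
        rw [smul_sub]; abel
      have h4 : ‖τ • (Φ (y n) - Φ (Y (n * τ)))‖ ≤ τ * (K * ‖y n - Y (n * τ)‖) := by
        rw [norm_smul, Real.norm_of_nonneg hτ0.le]; gcongr
      have h5 : ‖y (n+1) - Y (n * τ + τ)‖ ≤ D * τ ^ 2 + (1 + K * τ) * ‖y n - Y (n * τ)‖ := by
        rw [e2]
        refine (norm_add_le _ _).trans ?_
        have := norm_sub_le (y (n+1) - y n - τ • Φ (y n))
          (Y (n * τ + τ) - Y (n * τ) - τ • Φ (Y (n * τ)))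
        have := norm_add_le (y n - Y (n * τ)) (τ • (Φ (y n) - Φ (Y (n * τ))))
        rw [hD]; linarith
      have hq : 1 ≤ 1 + K * τ := by linarith [mul_nonneg hK hτ0.le]
      have h6 : 1 ≤ (1 + K * τ) ^ (n+1) := one_le_pow₀ hq
      calc _ ≤ D * τ ^ 2 + (1 + K * τ) * ‖y n - Y (n * τ)‖ := h5
        _ ≤ D * τ ^ 2 * (1 + K * τ) ^ (n+1)
            + (1 + K * τ) * (n * τ ^ 2 * D * (1 + K * τ) ^ n) := by
          refine add_le_add (le_mul_of_one_le_right (by positivity) h6) ?_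
          gcongr
        _ = _ := by push_cast; ring
  intro n hn
  have hnT : (n:ℝ) * τ ≤ T := by rw [← hNτ]; gcongr
  have hexp : (1 + K * τ) ^ n ≤ Real.exp (K * T) := by
    calc (1 + K * τ) ^ n ≤ (Real.exp (K * τ)) ^ n := by
          gcongr; linarith [Real.add_one_le_exp (K * τ)]
      _ = Real.exp (K * (n * τ)) := by rw [← Real.exp_nat_mul]; ring_nf
      _ ≤ _ := by gcongr
  calc _ ≤ n * τ ^ 2 * D * (1 + K * τ) ^ n := main n hn
    _ = D * (n * τ) * (1 + K * τ) ^ n * τ := by ring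
    _ ≤ D * T * Real.exp (K * T) * τ := by gcongr
    _ ≤ _ := by linarith
end euler

section step
variable {E : Type*} [NormedAddCommGroup E] [InnerProductSpace ℝ E] {k : ℕ}

/-- right-hand side of the equation for `x` -/
def hisdPX (x : E) (v : Fin k → E) (f : E) : E :=
  (f - (2:ℝ) • ∑ j, ⟪v j, f⟫ • v j) - ⟪x, f⟫ • x

/-- right-hand side of the equation for `v_i` -/
def hisdPV (x : E) (v : Fin k → E) (f : E) (A : E →L[ℝ] E) (i : Fin k) : E :=
  A (v i) + ((-⟪v i, A (v i)⟫) • v i - (2:ℝ) • ∑ j ∈ Finset.Iio i, ⟪v j, A (v i)⟫ • v j) -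
          ⟪x, A (v i)⟫ • x + ⟪v i, f⟫ • x

/-- one step of the scheme, from an admissible state -/
structure HisdStep (E : Type*) [NormedAddCommGroup E] [InnerProductSpace ℝ E] (k : ℕ)
    (B : ℝ) where
  τ : ℝ
  x : E
  v : Fin k → E
  f : E
  A : E →L[ℝ] E
  x' : E
  v' : Fin k → E
  hx : ‖x‖ = 1
  hv : ∀ i j : Fin k, ⟪v i, v j⟫ = if i = j then (1:ℝ) else 0
  hvx : ∀ i : Fin k, ⟪v i, x⟫ = 0
  hf : ‖f‖ ≤ B
  hA : ‖A‖ ≤ B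
  hsymm : ∀ u w, ⟪A u, w⟫ = ⟪u, A w⟫
  hx' : x' = ‖x + τ • (f - (2:ℝ) • ∑ j, ⟪v j, f⟫ • v j)‖⁻¹ •
    (x + τ • (f - (2:ℝ) • ∑ j, ⟪v j, f⟫ • v j))
  hv' : ∀ i : Fin k,
    let vt := v i + τ • A (v i)
    let vh := vt - ⟪vt, x'⟫ • x'
    let w := vh - ∑ j ∈ Finset.Iio i, ⟪vh, v' j⟫ • v' j
    v' i = ‖w‖⁻¹ • w

theorem hisd_inner_S {x : E} {v : Fin k → E} (f : E)
    (hvx : ∀ i : Fin k, ⟪v i, x⟫ = 0) :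
    ⟪x, f - (2:ℝ) • ∑ j, ⟪v j, f⟫ • v j⟫ = ⟪x, f⟫ := by
  have hxv : ∀ i, ⟪x, v i⟫ = 0 := fun i => by rw [real_inner_comm]; exact hvx i
  simp [inner_sub_right, inner_smul_right, inner_sum, hxv]

theorem hisd_inner_v_PX {x : E} {v : Fin k → E} (f : E)
    (hv : ∀ i j : Fin k, ⟪v i, v j⟫ = if i = j then (1:ℝ) else 0)
    (hvx : ∀ i : Fin k, ⟪v i, x⟫ = 0) (i : Fin k) :
    ⟪v i, hisdPX x v f⟫ = - ⟪v i, f⟫ := by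
  simp [hisdPX, inner_sub_right, inner_smul_right, inner_sum, hvx, hv]
  ring

theorem hisd_step_O (B : ℝ) (l : Filter (HisdStep E k B))
    (hτ : Tendsto (fun p : HisdStep E k B => p.τ) l (𝓝 0)) :
    HisdEx l (fun p => p.τ) (fun p => p.x) (fun p => hisdPX p.x p.v p.f) (fun p => p.x') ∧
    ∀ i : Fin k, HisdEx l (fun p => p.τ) (fun p => p.v i)
      (fun p => hisdPV p.x p.v p.f p.A i) (fun p => p.v' i) := by
  have nv : ∀ (p : HisdStep E k B) i, ‖p.v i‖ = 1 := by
    intro p i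
    have := p.hv i i
    rw [if_pos rfl, real_inner_self_eq_norm_sq] at this
    exact (pow_eq_one_iff_of_nonneg (norm_nonneg _) two_ne_zero).1 this
  have hxO : (fun p : HisdStep E k B => p.x) =O[l] (fun _ => (1:ℝ)) :=
    IsBigO.of_bound 1 (Eventually.of_forall fun p => by simp [p.hx])
  have hvO : ∀ i, (fun p : HisdStep E k B => p.v i) =O[l] (fun _ => (1:ℝ)) := fun i =>
    IsBigO.of_bound 1 (Eventually.of_forall fun p => by simp [nv p i])
  have hAO : ∀ i, (fun p : HisdStep E k B => p.A (p.v i)) =O[l] (fun _ => (1:ℝ)) := fun i =>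
    IsBigO.of_bound B (Eventually.of_forall fun p => by
      have := p.A.le_opNorm (p.v i)
      rw [nv, mul_one] at this
      simpa using this.trans p.hA)
  have hSO : (fun p : HisdStep E k B => p.f - (2:ℝ) • ∑ j, ⟪p.v j, p.f⟫ • p.v j)
      =O[l] (fun _ => (1:ℝ)) := by
    have hfO : (fun p : HisdStep E k B => p.f) =O[l] (fun _ => (1:ℝ)) :=
      IsBigO.of_bound B (Eventually.of_forall fun p => by simpa using p.hf)
    refine hfO.sub (IsBigO.const_smul_left ?_ _)
    refine IsBigO.fun_sum fun j _ => ?_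
    refine IsBigO.of_bound B (Eventually.of_forall fun p => ?_)
    rw [norm_smul, nv, mul_one]
    have := norm_inner_le_norm (𝕜 := ℝ) (p.v j) p.f
    rw [nv, one_mul] at this
    simpa using this.trans p.hf
  have ex : HisdEx l (fun p => p.τ) (fun p => p.x) (fun p => hisdPX p.x p.v p.f)
      (fun p => p.x') := by
    refine ((HisdEx.mk_exact hxO hSO).normalize hτ (fun p => p.hx)).congr (fun _ => rfl) ?_ ?_
    · intro p; rw [hisd_inner_S p.f p.hvx]; rfl
    · intro p; exact p.hx'.symm
  refine ⟨ex, ?_⟩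
  intro i
  induction i using WellFoundedLT.induction with
  | ind i ih =>
  have evt : HisdEx l (fun p => p.τ) (fun p => p.v i) (fun p => p.A (p.v i))
      (fun p => p.v i + p.τ • p.A (p.v i)) := HisdEx.mk_exact (hvO i) (hAO i)
  have evh := evt.sub ((evt.inner hτ ex).smul hτ ex)
  have evh' : HisdEx l (fun p => p.τ) (fun p => p.v i)
      (fun p => p.A (p.v i) - ⟪p.x, p.A (p.v i)⟫ • p.x + ⟪p.v i, p.f⟫ • p.x)
      (fun p => p.v i + p.τ • p.A (p.v i) - ⟪p.v i + p.τ • p.A (p.v i), p.x'⟫ • p.x') := by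
    refine evh.congr ?_ ?_ (fun _ => rfl)
    · intro p; simp [p.hvx]
    · intro p
      rw [hisd_inner_v_PX p.f p.hv p.hvx, p.hvx, real_inner_comm p.x]
      module
  clear evh
  have esum := HisdEx.sum (Finset.Iio i) (fun j hj =>
    (evh'.inner hτ (ih j (Finset.mem_Iio.1 hj))).smul hτ (ih j (Finset.mem_Iio.1 hj)))
  have esum' : HisdEx l (fun p => p.τ) (fun _ => (0:E))
      (fun p => ∑ j ∈ Finset.Iio i, (2 * ⟪p.v j, p.A (p.v i)⟫) • p.v j)
      (fun p => ∑ j ∈ Finset.Iio i, ⟪p.v i + p.τ • p.A (p.v i) -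
        ⟪p.v i + p.τ • p.A (p.v i), p.x'⟫ • p.x', p.v' j⟫ • p.v' j) := by
    refine esum.congr (fun p => ?_) (fun p => ?_) (fun _ => rfl)
    · refine Finset.sum_eq_zero fun j hj => ?_
      have hne : i ≠ j := (Finset.mem_Iio.1 hj).ne'
      simp [p.hv, hne]
    · refine Finset.sum_congr rfl fun j hj => ?_
      have hji := Finset.mem_Iio.1 hj
      have hne : i ≠ j := hji.ne'
      have hxv : ∀ i, ⟪p.x, p.v i⟫ = 0 := fun i => by rw [real_inner_comm]; exact p.hvx i
      have hs : ∑ m ∈ Finset.Iio j, ⟪p.v m, p.A (p.v j)⟫ * ⟪p.v i, p.v m⟫ = 0 := by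
        refine Finset.sum_eq_zero fun m hm => ?_
        have : i ≠ m := ((Finset.mem_Iio.1 hm).trans hji).ne'
        simp [p.hv, this]
      have h1 : ⟪p.v i, hisdPV p.x p.v p.f p.A j⟫ = ⟪p.v j, p.A (p.v i)⟫ := by
        simp only [hisdPV, inner_add_right, inner_sub_right, inner_smul_right, inner_sum, hs,
          p.hvx, p.hv i j, if_neg hne]
        rw [← p.hsymm, real_inner_comm]
        ring
      have h2 : ⟪p.A (p.v i) - ⟪p.x, p.A (p.v i)⟫ • p.x + ⟪p.v i, p.f⟫ • p.x, p.v j⟫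
          = ⟪p.v j, p.A (p.v i)⟫ := by
        simp only [inner_add_left, inner_sub_left, inner_smul_left, hxv]
        rw [real_inner_comm]; simp
      rw [h1, h2, p.hv i j, if_neg hne]
      module
  have ew := (evh'.sub esum').congr (fun p => sub_zero (p.v i)) (fun _ => rfl) (fun _ => rfl)
  refine (ew.normalize hτ (fun p => nv p i)).congr (fun _ => rfl) ?_ ?_
  · intro p
    have hs : ∑ m ∈ Finset.Iio i, (2 * ⟪p.v m, p.A (p.v i)⟫) * ⟪p.v i, p.v m⟫ = 0 := by
      refine Finset.sum_eq_zero fun m hm => ?_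
      have : i ≠ m := (Finset.mem_Iio.1 hm).ne'
      simp [p.hv, this]
    have h3 : ⟪p.v i, p.A (p.v i) - ⟪p.x, p.A (p.v i)⟫ • p.x + ⟪p.v i, p.f⟫ • p.x
        - ∑ j ∈ Finset.Iio i, (2 * ⟪p.v j, p.A (p.v i)⟫) • p.v j⟫ = ⟪p.v i, p.A (p.v i)⟫ := by
      simp only [inner_add_right, inner_sub_right, inner_smul_right, inner_sum, hs, p.hvx]
      ring
    rw [h3]
    simp only [hisdPV, mul_smul, ← Finset.smul_sum]
    module
  · intro p; exact (p.hv' i).symm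

theorem hisd_step (E : Type*) [NormedAddCommGroup E] [InnerProductSpace ℝ E] (k : ℕ) (B : ℝ) :
    ∃ τ₀ > (0:ℝ), ∃ C ≥ (0:ℝ), ∀ p : HisdStep E k B, 0 < p.τ → p.τ ≤ τ₀ →
      ‖p.x' - p.x - p.τ • hisdPX p.x p.v p.f‖ ≤ C * p.τ ^ 2 ∧
      ∀ i, ‖p.v' i - p.v i - p.τ • hisdPV p.x p.v p.f p.A i‖ ≤ C * p.τ ^ 2 := by
  set l : Filter (HisdStep E k B) := comap (fun p => p.τ) (𝓝 0) with hl
  have hτ : Tendsto (fun p : HisdStep E k B => p.τ) l (𝓝 0) := tendsto_comap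
  obtain ⟨h1, h2⟩ := hisd_step_O B l hτ
  obtain ⟨C1, hC1, hb1⟩ := h1.ex.exists_nonneg
  choose C2 hC2 hb2 using fun i => (h2 i).ex.exists_nonneg
  have hev := hb1.bound.and (eventually_all.2 fun i => (hb2 i).bound)
  rw [hl, eventually_comap, Metric.eventually_nhds_iff] at hev
  obtain ⟨ε, hε, hev⟩ := hev
  have hS : 0 ≤ ∑ i, C2 i := Finset.sum_nonneg fun i _ => hC2 i
  refine ⟨ε / 2, by positivity, C1 + ∑ i, C2 i, by positivity, fun p hp hpe => ?_⟩
  obtain ⟨g1, g2⟩ := hev (y := p.τ) (by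
    rw [Real.dist_eq, sub_zero, abs_of_pos hp]; linarith) p rfl
  rw [Real.norm_of_nonneg (by positivity)] at g1
  refine ⟨g1.trans (by gcongr; linarith), fun i => ?_⟩
  have g3 := g2 i
  rw [Real.norm_of_nonneg (by positivity)] at g3
  refine g3.trans ?_
  gcongr
  have := Finset.single_le_sum (f := C2) (fun i _ => hC2 i) (Finset.mem_univ i)
  linarith

/-- the vector field on the product space -/
def hisdPhi (F : E → E) (J : E → E →L[ℝ] E) (z : E × (Fin k → E)) : E × (Fin k → E) :=
  (hisdPX z.1 z.2 (F z.1), fun i => hisdPV z.1 z.2 (F z.1) (J z.1) i)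

theorem hisdPhi_lip [FiniteDimensional ℝ E] (F : E → E) (J : E → E →L[ℝ] E) (L : ℝ) (hL : 0 < L)
    (hLip : ∀ x₁ x₂ : E, ‖J x₂ - J x₁‖ + ‖F x₂ - F x₁‖ ≤ L * ‖x₂ - x₁‖) (M : ℝ) :
    ∃ K ≥ (0:ℝ), ∀ a b : E × (Fin k → E), ‖a‖ ≤ M → ‖b‖ ≤ M →
      ‖hisdPhi F J a - hisdPhi F J b‖ ≤ K * ‖a - b‖ := by
  have hF : LocallyLipschitz F := by
    refine (LipschitzWith.of_dist_le_mul (K := ⟨L, hL.le⟩) fun a b => ?_).locallyLipschitz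
    have := hLip b a
    rw [dist_eq_norm, dist_eq_norm]
    have := norm_nonneg (J a - J b)
    change _ ≤ L * _
    linarith
  have hJ : LocallyLipschitz J := by
    refine (LipschitzWith.of_dist_le_mul (K := ⟨L, hL.le⟩) fun a b => ?_).locallyLipschitz
    have := hLip b a
    rw [dist_eq_norm, dist_eq_norm]
    have := norm_nonneg (F a - F b)
    change _ ≤ L * _
    linarith
  have hfst : LocallyLipschitz (fun z : E × (Fin k → E) => z.1) :=
    LipschitzWith.prod_fst.locallyLipschitz
  have hin : LocallyLipschitz (fun z : E × (Fin k → E) => (z, (F z.1, J z.1))) :=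
    LocallyLipschitz.id.prodMk ((hF.comp hfst).prodMk (hJ.comp hfst))
  have hG : ContDiff ℝ 1 (fun y : (E × (Fin k → E)) × (E × (E →L[ℝ] E)) =>
      ((hisdPX y.1.1 y.1.2 y.2.1, fun i => hisdPV y.1.1 y.1.2 y.2.1 y.2.2 i) :
        E × (Fin k → E))) := by
    have h1 : ∀ i, ContDiff ℝ 1 (fun y : (E × (Fin k → E)) × (E × (E →L[ℝ] E)) => y.1.2 i) := by
      intro i; fun_prop
    have h2 : ∀ i, ContDiff ℝ 1 (fun y : (E × (Fin k → E)) × (E × (E →L[ℝ] E)) =>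
        y.2.2 (y.1.2 i)) := by
      intro i; exact ContDiff.clm_apply (by fun_prop) (h1 i)
    have h3 : ContDiff ℝ 1 (fun y : (E × (Fin k → E)) × (E × (E →L[ℝ] E)) => y.1.1) := by
      fun_prop
    have h4 : ContDiff ℝ 1 (fun y : (E × (Fin k → E)) × (E × (E →L[ℝ] E)) => y.2.1) := by
      fun_prop
    refine ContDiff.prodMk ?_ (contDiff_pi.2 fun i => ?_)
    · unfold hisdPX
      refine (h4.sub (contDiff_const.smul (ContDiff.sum fun j _ =>
        ((h1 j).inner ℝ h4).smul (h1 j)))).sub ((h3.inner ℝ h4).smul h3)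
    · unfold hisdPV
      refine (((h2 i).add (((((h1 i).inner ℝ (h2 i)).neg).smul (h1 i)).sub
        (contDiff_const.smul (ContDiff.sum fun j _ =>
        ((h1 j).inner ℝ (h2 i)).smul (h1 j))))).sub ((h3.inner ℝ (h2 i)).smul h3)).add
        (((h1 i).inner ℝ h4).smul h3)
  have hΦ : LocallyLipschitz (hisdPhi F J : E × (Fin k → E) → E × (Fin k → E)) :=
    hG.locallyLipschitz.comp hin
  obtain ⟨K, hK⟩ := (hΦ.locallyLipschitzOn (s := Metric.closedBall 0 M)
    ).exists_lipschitzOnWith_of_compact (isCompact_closedBall _ _)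
  refine ⟨K, K.2, fun a b ha hb => ?_⟩
  have := hK.dist_le_mul a (by simpa using ha) b (by simpa using hb)
  simpa [dist_eq_norm] using this

end step

section invariants
variable {E : Type*} [NormedAddCommGroup E] [InnerProductSpace ℝ E] {k : ℕ}

theorem hisd_unit {w : E} (hw : w ≠ 0) : ‖‖w‖⁻¹ • w‖ = 1 := by
  rw [norm_smul, norm_inv, norm_norm, inv_mul_cancel₀ (norm_ne_zero_iff.2 hw)]

theorem hisd_gs (x' : E) (hx' : ‖x'‖ = 1) (vt v' : Fin k → E)
    (h : ∀ i : Fin k,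
          let vh := vt i - ⟪vt i, x'⟫ • x'
          let w := vh - ∑ j ∈ Finset.Iio i, ⟪vh, v' j⟫ • v' j
          w ≠ 0 ∧ v' i = ‖w‖⁻¹ • w) :
    (∀ i j : Fin k, ⟪v' i, v' j⟫ = if i = j then (1:ℝ) else 0) ∧ ∀ i, ⟪v' i, x'⟫ = 0 := by
  have nv : ∀ i, ‖v' i‖ = 1 := fun i => by
    rw [(h i).2]; exact hisd_unit (h i).1
  have hx : ∀ i, ⟪v' i, x'⟫ = 0 := by
    intro i
    induction i using WellFoundedLT.induction with
    | ind i ih =>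
    have hs : ∑ j ∈ Finset.Iio i, ⟪vt i - ⟪vt i, x'⟫ • x', v' j⟫ * ⟪v' j, x'⟫ = 0 :=
      Finset.sum_eq_zero fun j hj => by rw [ih j (Finset.mem_Iio.1 hj), mul_zero]
    rw [(h i).2, real_inner_smul_left, inner_sub_left, sum_inner]
    simp only [real_inner_smul_left, hs]
    rw [inner_sub_left, real_inner_smul_left, real_inner_self_eq_norm_sq, hx']
    ring
  have hlt : ∀ i, ∀ j < i, ⟪v' i, v' j⟫ = 0 := by
    intro i
    induction i using WellFoundedLT.induction with
    | ind i ih =>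
    intro j hj
    have hs : ∑ m ∈ Finset.Iio i, ⟪vt i - ⟪vt i, x'⟫ • x', v' m⟫ * ⟪v' m, v' j⟫ =
        ⟪vt i - ⟪vt i, x'⟫ • x', v' j⟫ := by
      rw [Finset.sum_eq_single j]
      · rw [real_inner_self_eq_norm_sq, nv]; ring
      · intro m hm hmj
        rcases lt_or_gt_of_ne hmj with hlt | hgt
        · rw [real_inner_comm (v' j) (v' m), ih j hj m hlt, mul_zero]
        · rw [ih m (Finset.mem_Iio.1 hm) j hgt, mul_zero]
      · intro hn; exact absurd (Finset.mem_Iio.2 hj) hn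
    rw [(h i).2, real_inner_smul_left, inner_sub_left, sum_inner]
    simp only [real_inner_smul_left, hs]
    ring
  refine ⟨fun i j => ?_, hx⟩
  rcases lt_trichotomy i j with hij | hij | hij
  · rw [if_neg hij.ne, real_inner_comm, hlt j i hij]
  · subst hij; rw [if_pos rfl, real_inner_self_eq_norm_sq, nv]; ring
  · rw [if_neg hij.ne', hlt i j hij]

end invariants

theorem hisd_stmt18
    (d k : ℕ) (hd : 1 ≤ d) (hk : 1 ≤ k) (hkd : k ≤ d)
    (F : EuclideanSpace ℝ (Fin d) → EuclideanSpace ℝ (Fin d))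
    (J : EuclideanSpace ℝ (Fin d) → (EuclideanSpace ℝ (Fin d) →L[ℝ] EuclideanSpace ℝ (Fin d)))
    (hJsymm : ∀ x u w, ⟪J x u, w⟫ = ⟪u, J x w⟫)
    (L : ℝ) (hL : 0 < L)
    (hLip : ∀ x₁ x₂ : EuclideanSpace ℝ (Fin d), ‖J x₂ - J x₁‖ + ‖F x₂ - F x₁‖ ≤ L * ‖x₂ - x₁‖)
    (hgrow : ∀ x : EuclideanSpace ℝ (Fin d), ‖F x‖ ≤ L * (1 + ‖x‖))
    (T : ℝ) (hT : 0 < T)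
    (x₀ : EuclideanSpace ℝ (Fin d)) (hx₀ : ‖x₀‖ = 1)
    (v₀ : Fin k → EuclideanSpace ℝ (Fin d))
    (hv₀ : ∀ i j : Fin k, ⟪v₀ i, v₀ j⟫ = if i = j then (1:ℝ) else 0)
    (hv₀x : ∀ i : Fin k, ⟪v₀ i, x₀⟫ = 0)
    (X : ℝ → EuclideanSpace ℝ (Fin d)) (V : ℝ → Fin k → EuclideanSpace ℝ (Fin d))
    (hX0 : X 0 = x₀) (hV0 : V 0 = v₀)
    (hXreg : ContDiffOn ℝ 2 X (Set.Icc 0 T))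
    (hVreg : ∀ i : Fin k, ContDiffOn ℝ 2 (fun t => V t i) (Set.Icc 0 T))
    (hXode : ∀ t ∈ Set.Icc (0:ℝ) T, HasDerivWithinAt X
        ((F (X t) - (2:ℝ) • ∑ j, ⟪V t j, F (X t)⟫ • V t j) -
          ⟪X t, F (X t)⟫ • X t) (Set.Icc 0 T) t)
    (hVode : ∀ t ∈ Set.Icc (0:ℝ) T, ∀ i : Fin k, HasDerivWithinAt (fun s => V s i)
        (J (X t) (V t i) + ((-⟪V t i, J (X t) (V t i)⟫) • V t i -
          (2:ℝ) • ∑ j ∈ Finset.Iio i, ⟪V t j, J (X t) (V t i)⟫ • V t j) -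
          ⟪X t, J (X t) (V t i)⟫ • X t +
          ⟪V t i, F (X t)⟫ • X t) (Set.Icc 0 T) t) :
    ∃ τ₀ > (0:ℝ), ∃ Q > (0:ℝ), ∀ (N : ℕ) (τ : ℝ), 0 < N → τ = T / N → τ ≤ τ₀ →
      ∀ (x : ℕ → EuclideanSpace ℝ (Fin d)) (v : ℕ → Fin k → EuclideanSpace ℝ (Fin d)),
        x 0 = x₀ → v 0 = v₀ →
        (∀ n < N,
          let xt := x n + τ • (F (x n) - (2:ℝ) • ∑ j, ⟪v n j, F (x n)⟫ • v n j)
          xt ≠ 0 ∧ x (n+1) = ‖xt‖⁻¹ • xt) →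
        (∀ n < N, ∀ i : Fin k,
          let vt := v n i + τ • J (x n) (v n i)
          let vh := vt - ⟪vt, x (n+1)⟫ • x (n+1)
          let w := vh - ∑ j ∈ Finset.Iio i, ⟪vh, v (n+1) j⟫ • v (n+1) j
          w ≠ 0 ∧ v (n+1) i = ‖w‖⁻¹ • w) →
        ∀ n : ℕ, 1 ≤ n → n ≤ N →
          ‖x n - X (n * τ)‖ + ∑ i, ‖v n i - V (n * τ) i‖ ≤ Q * τ := by
  have nv : ∀ (u : Fin k → EuclideanSpace ℝ (Fin d)),
      (∀ i j : Fin k, ⟪u i, u j⟫ = if i = j then (1:ℝ) else 0) → ∀ i, ‖u i‖ = 1 := by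
    intro u hu i
    have := hu i i
    rw [if_pos rfl, real_inner_self_eq_norm_sq] at this
    exact (pow_eq_one_iff_of_nonneg (norm_nonneg _) two_ne_zero).1 this
  set Y : ℝ → EuclideanSpace ℝ (Fin d) × (Fin k → EuclideanSpace ℝ (Fin d)) :=
    fun t => (X t, V t) with hYdef
  have hY : ∀ t ∈ Set.Icc (0:ℝ) T,
      HasDerivWithinAt Y (hisdPhi F J (Y t)) (Set.Icc 0 T) t := by
    intro t ht
    exact (hXode t ht).prodMk (hasDerivWithinAt_pi.2 fun i => hVode t ht i)
  have hYc : ContinuousOn Y (Set.Icc 0 T) := fun t ht => (hY t ht).continuousWithinAt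
  obtain ⟨M0, hM0⟩ := isCompact_Icc.exists_bound_of_continuousOn hYc
  set M := max M0 1 with hM
  have hM1 : 1 ≤ M := le_max_right _ _
  set B := 2 * L + ‖J 0‖ with hB
  obtain ⟨K, hK, hΦ⟩ := hisdPhi_lip (k := k) F J L hL hLip M
  obtain ⟨τ₀, hτ₀, C, hC, hstep⟩ := hisd_step (EuclideanSpace ℝ (Fin d)) k B
  obtain ⟨Q, hQ, heuler⟩ := hisd_euler (hisdPhi F J) K M T C hK hT hC (by linarith) hΦ Y
    (fun t ht => (hM0 t ht).trans (le_max_left _ _)) hY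
  refine ⟨τ₀, hτ₀, (k + 1) * Q, by positivity, ?_⟩
  intro N τ hN hτ hττ x v hx0 hv0 hx hv n hn1 hnN
  have hτpos : 0 < τ := by
    have : (0:ℝ) < N := by exact_mod_cast hN
    rw [hτ]; positivity
  have inv : ∀ n ≤ N, ‖x n‖ = 1 ∧
      (∀ i j : Fin k, ⟪v n i, v n j⟫ = if i = j then (1:ℝ) else 0) ∧
      ∀ i, ⟪v n i, x n⟫ = 0 := by
    intro n
    induction n with
    | zero => intro _; rw [hx0, hv0]; exact ⟨hx₀, hv₀, hv₀x⟩
    | succ n _ =>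
      intro hn
      have h1 : ‖x (n+1)‖ = 1 := by
        rw [(hx n hn).2]; exact hisd_unit (hx n hn).1
      exact ⟨h1, hisd_gs (x (n+1)) h1 (fun i => v n i + τ • J (x n) (v n i)) (v (n+1))
        (hv n hn)⟩
  have hfin := heuler N τ hN hτ (fun n => (x n, v n)) (by simp [hYdef, hx0, hv0, hX0, hV0])
    (by
      intro n hn
      obtain ⟨h1, h2, h3⟩ := inv n hn
      refine norm_prod_le_iff.2 ⟨by simpa [h1] using hM1, ?_⟩
      refine (pi_norm_le_iff_of_nonneg (by linarith)).2 fun i => ?_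
      simpa [nv _ h2 i] using hM1)
    (by
      intro n hn
      obtain ⟨h1, h2, h3⟩ := inv n hn.le
      have hfB : ‖F (x n)‖ ≤ B := by
        have := hgrow (x n)
        rw [h1] at this
        have := norm_nonneg (J 0)
        linarith
      have hJB : ‖J (x n)‖ ≤ B := by
        have h4 := hLip 0 (x n)
        rw [sub_zero, h1] at h4
        have h5 := norm_nonneg (F (x n) - F 0)
        have h6 : ‖J (x n)‖ ≤ ‖J (x n) - J 0‖ + ‖J 0‖ := by
          simpa using norm_add_le (J (x n) - J 0) (J 0)
        linarith
      have hs := hstep ⟨τ, x n, v n, F (x n), J (x n), x (n+1), v (n+1), h1, h2, h3, hfB, hJB,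
        hJsymm (x n), (hx n hn).2, fun i => (hv n hn i).2⟩ hτpos hττ
      refine norm_prod_le_iff.2 ⟨hs.1, ?_⟩
      refine (pi_norm_le_iff_of_nonneg (by positivity)).2 fun i => hs.2 i)
    n hnN
  obtain ⟨g1, g2⟩ := norm_prod_le_iff.1 hfin
  have g3 : ∀ i, ‖v n i - V (n * τ) i‖ ≤ Q * τ := fun i =>
    (norm_le_pi_norm (v n - V (n * τ)) i).trans g2
  have g4 : ∑ i, ‖v n i - V (n * τ) i‖ ≤ k * (Q * τ) := by
    have := Finset.sum_le_card_nsmul Finset.univ _ _ (fun i _ => g3 i)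
    simpa using this
  have g5 : ‖x n - X (n * τ)‖ ≤ Q * τ := g1
  calc _ ≤ Q * τ + k * (Q * τ) := add_le_add g5 g4
    _ = _ := by ring
end
end
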